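/- arXiv:0809.1386 — 4 statements merged into one kernel-verified Lean document; each statement's English description precedes it below -/
import Mathlib

section
/- Let k be a field of characteristic zero. Then there exists a field extension L of k such that: (i) k is algebraically closed in L (every element of L algebraic over k lies in k), and (ii) L is pseudo-algebraically closed, i.e. every geometrically integral L-variety has an L-rational point. -/
open AlgebraicGeometry CategoryTheory CategoryTheory.Limits

/-- The base change of an `L`-scheme `X` (with structure morphism `f : X ⟶ Spec L`) to an
algebraic closure of `L`. -/
noncomputable def geomFiber (L : Type) [Field L] {X : Scheme}
    (f : X ⟶ Spec (CommRingCat.of L)) : Scheme :=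
  pullback f (Spec.map (CommRingCat.ofHom (algebraMap L (AlgebraicClosure L))))

/-- An `L`-scheme is geometrically integral if its base change to an algebraic closure of `L`
is an integral scheme. -/
def GeometricallyIntegral (L : Type) [Field L] {X : Scheme}
    (f : X ⟶ Spec (CommRingCat.of L)) : Prop :=
  IsIntegral (geomFiber L f)

open TensorProduct

/-- A nonzero element of a finite type domain over an algebraically closed field is nonzero at
some rational point. -/
theorem exists_algHom_apply_ne_zero (C : Type*) {A : Type*} [Field C] [IsAlgClosed C] [CommRing A]
    [IsDomain A] [Algebra C A] [Algebra.FiniteType C A] {a : A} (ha : a ≠ 0) :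
    ∃ φ : A →ₐ[C] C, φ a ≠ 0 := by
  have : IsDomain (Localization.Away a) := IsLocalization.isDomain_localization
    (powers_le_nonZeroDivisors_of_noZeroDivisors ha)
  have : Algebra.FiniteType A (Localization.Away a) :=
    IsLocalization.finiteType_of_monoid_fg (.powers a) _
  have : Algebra.FiniteType C (Localization.Away a) := .trans ‹_› this
  obtain ⟨m, hm⟩ := Ideal.exists_maximal (Localization.Away a)
  let := Ideal.Quotient.field m
  have := finite_of_finite_type_of_isJacobsonRing C (Localization.Away a ⧸ m)
  let e : C ≃ₐ[C] (Localization.Away a ⧸ m) := AlgEquiv.ofBijective (Algebra.ofId _ _)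
    IsAlgClosed.algebraMap_bijective_of_isIntegral
  refine ⟨(e.symm : _ →ₐ[C] C).comp ((Ideal.Quotient.mkₐ C m).comp
    (IsScalarTower.toAlgHom C A (Localization.Away a))), ?_⟩
  exact (((IsLocalization.Away.algebraMap_isUnit (S := Localization.Away a) a).map
    (Ideal.Quotient.mkₐ C m)).map (e.symm : _ →ₐ[C] C)).ne_zero

/-- The tensor product of two domains, one of them of finite type, over an algebraically closed
field is a domain. -/
theorem isDomain_tensorProduct_of_isAlgClosed (C A B : Type*) [Field C] [IsAlgClosed C]
    [CommRing A] [IsDomain A] [Algebra C A] [Algebra.FiniteType C A] [CommRing B] [IsDomain B]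
    [Algebra C B] : IsDomain (A ⊗[C] B) := by
  let b := Module.Basis.ofVectorSpace C B
  let bA := b.baseChange A
  have key (φ : A →ₐ[C] C) (u : A ⊗[C] B) (i) :
      b.repr (Algebra.TensorProduct.lift ((Algebra.ofId C B).comp φ) (AlgHom.id C B)
        (fun _ _ ↦ .all _ _) u) i = φ (bA.repr u i) := by
    induction u with
    | zero => simp
    | add x y hx hy => simp [hx, hy]
    | tmul x y =>
      simp only [Algebra.TensorProduct.lift_tmul, AlgHom.comp_apply, Algebra.ofId_apply,
        AlgHom.id_apply, ← Algebra.smul_def, bA, Module.Basis.baseChange_repr_tmul]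
      simp [mul_comm]
  have : NoZeroDivisors (A ⊗[C] B) := by
    refine ⟨fun {u v} huv ↦ ?_⟩
    by_contra! h
    obtain ⟨i, hi⟩ : ∃ i, bA.repr u i ≠ 0 := by
      by_contra! h'; exact h.1 (bA.repr.map_eq_zero_iff.mp (Finsupp.ext h'))
    obtain ⟨j, hj⟩ : ∃ j, bA.repr v j ≠ 0 := by
      by_contra! h'; exact h.2 (bA.repr.map_eq_zero_iff.mp (Finsupp.ext h'))
    obtain ⟨φ, hφ⟩ := exists_algHom_apply_ne_zero C (mul_ne_zero hi hj)
    rw [map_mul, ← key, ← key] at hφ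
    have h0 := congr(Algebra.TensorProduct.lift ((Algebra.ofId C B).comp φ) (AlgHom.id C B)
        (fun _ _ ↦ .all _ _) $huv)
    rw [map_mul, map_zero, mul_eq_zero] at h0
    rcases h0 with h0 | h0 <;> simp [h0] at hφ
  have : Nontrivial (A ⊗[C] B) := inferInstance
  exact NoZeroDivisors.to_isDomain _

theorem isDomain_tensorProduct_tensorProduct (C K A B : Type*) [Field K] [Field C] [IsAlgClosed C]
    [Algebra K C] [CommRing A] [Algebra K A] [Algebra.FiniteType K A] [CommRing B] [Algebra K B]
    [IsDomain (C ⊗[K] A)] [IsDomain (C ⊗[K] B)] : IsDomain (C ⊗[K] (A ⊗[K] B)) := by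
  have := isDomain_tensorProduct_of_isAlgClosed C (C ⊗[K] A) (C ⊗[K] B)
  exact ((Algebra.TensorProduct.assoc K K C C A B).symm.trans
    (Algebra.TensorProduct.cancelBaseChange K C C (C ⊗[K] A) B).symm).toMulEquiv.isDomain _

/-- If `C ⊗ B` is a domain with `C` an algebraically closed extension of `K`, then `K` is
algebraically closed in the fraction field of `B`. -/
theorem mem_range_of_isAlgebraic_fractionRing (C K B F : Type*) [Field K] [Field C] [IsAlgClosed C]
    [Algebra K C] [CommRing B] [Algebra K B] [IsDomain B] [IsDomain (C ⊗[K] B)]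
    [Field F] [Algebra B F] [IsFractionRing B F] [Algebra K F] [IsScalarTower K B F]
    (x : F) (hx : IsAlgebraic K x) : ∃ a : K, algebraMap K F a = x := by
  let D := FractionRing (C ⊗[K] B)
  let j : B →ₐ[K] D := (IsScalarTower.toAlgHom K (C ⊗[K] B) D).comp
    Algebra.TensorProduct.includeRight
  have hj : Function.Injective j :=
    (IsFractionRing.injective (C ⊗[K] B) D).comp
      (Algebra.TensorProduct.includeRight_injective (algebraMap K C).injective)
  let J : F →ₐ[K] D := IsFractionRing.liftAlgHom hj
  obtain ⟨p, hp, hpx⟩ := hx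
  have hroot : Polynomial.aeval (J x) p = 0 := by
    rw [Polynomial.aeval_algHom_apply, hpx, map_zero]
  obtain ⟨a, ha⟩ : ∃ a : C, algebraMap C D a = J x := by
    have hint : IsIntegral C (J x) := (IsAlgebraic.tower_top C ⟨p, hp, hroot⟩).isIntegral
    have hdeg := IsAlgClosed.degree_eq_one_of_irreducible C (minpoly.irreducible hint)
    exact minpoly.mem_range_of_degree_eq_one C _ hdeg
  obtain ⟨b, c, hc, rfl⟩ := IsFractionRing.div_surjective (A := B) x
  have hc0 : c ≠ 0 := nonZeroDivisors.ne_zero hc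
  have hJ (y : B) : J (algebraMap B F y) = j y := IsFractionRing.lift_algebraMap hj y
  obtain ⟨g, hg⟩ : ∃ g : B →ₗ[K] K, g c = 1 := by
    obtain ⟨g, hg⟩ := Module.Projective.exists_dual_ne_zero K hc0
    exact ⟨(g c)⁻¹ • g, by simp [hg]⟩
  have hEq : (1 : C) ⊗ₜ[K] b = a ⊗ₜ c := by
    apply IsFractionRing.injective (C ⊗[K] B) D
    rw [map_div₀, hJ, hJ, eq_div_iff (by simpa using hj.ne hc0)] at ha
    change algebraMap (C ⊗[K] B) D (a ⊗ₜ 1) * algebraMap (C ⊗[K] B) D (1 ⊗ₜ c) =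
      algebraMap (C ⊗[K] B) D (1 ⊗ₜ b) at ha
    rw [← ha, ← map_mul]
    simp
  have hab : algebraMap K C (g b) = a := by
    simpa [hg, Algebra.smul_def] using congr(TensorProduct.rid K C (g.lTensor C $hEq))
  refine ⟨g b, J.injective ?_⟩
  change J _ = J _
  rw [← ha, ← hab, AlgHom.commutes, ← IsScalarTower.algebraMap_apply]

/-- The quotient of a polynomial ring by `I` becomes a domain after base change to `E` if and only
if the extension of `I` to `E` is prime. -/
theorem isDomain_tensorProduct_quotient_iff (K E : Type*) [Field K] [Field E] [Algebra K E]
    {σ : Type*} (I : Ideal (MvPolynomial σ K)) :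
    IsDomain (E ⊗[K] (MvPolynomial σ K ⧸ I)) ↔
      (I.map (MvPolynomial.map (algebraMap K E))).IsPrime := by
  let e₁ := Algebra.TensorProduct.tensorQuotientEquiv (R := K) E (MvPolynomial σ K) E I
  let e₂ := Ideal.quotientEquiv (I.map (Algebra.TensorProduct.includeRight (A := E) (R := K)))
    (I.map (MvPolynomial.map (algebraMap K E)))
    (MvPolynomial.algebraTensorAlgEquiv K E).toRingEquiv (by
      rw [← Ideal.map_coe (Algebra.TensorProduct.includeRight (A := E) (R := K)),
        Ideal.map_map]
      congr 1
      ext <;> simp)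
  let e := e₁.toRingEquiv.trans e₂
  rw [← Ideal.Quotient.isDomain_iff_prime]
  exact ⟨fun _ ↦ e.symm.toMulEquiv.isDomain _, fun _ ↦ e.toMulEquiv.isDomain _⟩

/-- An ideal of a polynomial ring over a field is geometrically prime if its extension to an
algebraic closure is prime. -/
def Ideal.IsGeometricallyPrime {K σ : Type*} [Field K] (I : Ideal (MvPolynomial σ K)) : Prop :=
  (I.map (MvPolynomial.map (algebraMap K (AlgebraicClosure K)))).IsPrime

theorem isDomain_of_isDomain_tensorProduct (K C B : Type*) [Field K] [Field C] [Algebra K C]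
    [CommRing B] [Algebra K B] [IsDomain (C ⊗[K] B)] : IsDomain B :=
  (Algebra.TensorProduct.includeRight_injective (R := K) (A := C) (B := B)
    (algebraMap K C).injective).isDomain (Algebra.TensorProduct.includeRight (R := K) (A := C)
      (B := B)).toRingHom

/-- Primality of an extended ideal descends along a field extension. -/
theorem Ideal.IsGeometricallyPrime.descend {K L σ : Type*} [Field K] [Field L] (ι : K →+* L)
    {I : Ideal (MvPolynomial σ K)} (h : (I.map (MvPolynomial.map ι)).IsGeometricallyPrime) :
    I.IsGeometricallyPrime := by
  algebraize [ι]
  unfold Ideal.IsGeometricallyPrime at h ⊢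
  have hcomp : (MvPolynomial.map (algebraMap L (AlgebraicClosure L))).comp
      (MvPolynomial.map (σ := σ) ι) = MvPolynomial.map (algebraMap K (AlgebraicClosure L)) := by
    rw [IsScalarTower.algebraMap_eq K L, RingHom.algebraMap_toAlgebra]
    ext <;> simp
  rw [Ideal.map_map, hcomp, ← isDomain_tensorProduct_quotient_iff] at h
  rw [← isDomain_tensorProduct_quotient_iff]
  let j : AlgebraicClosure K →ₐ[K] AlgebraicClosure L := IsAlgClosed.lift
  exact (Module.Flat.rTensor_preserves_injective_linearMap (M := MvPolynomial σ K ⧸ I)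
    j.toLinearMap j.injective).isDomain
      (Algebra.TensorProduct.map j (AlgHom.id K (MvPolynomial σ K ⧸ I))).toRingHom

/-- Finitely many geometrically prime ideals over `K` acquire zeros in a finite type `K`-algebra
which is geometrically a domain. -/
theorem exists_finiteType_algebra_zero {K : Type} [Field K] {ι : Type*} (n : ι → ℕ)
    (I : ∀ i, Ideal (MvPolynomial (Fin (n i)) K)) (hI : ∀ i, (I i).IsGeometricallyPrime)
    (s : Finset ι) :
    ∃ (B : Type) (_ : CommRing B) (_ : Algebra K B), Algebra.FiniteType K B ∧
      IsDomain (AlgebraicClosure K ⊗[K] B) ∧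
      ∀ i ∈ s, ∃ v : Fin (n i) → B, ∀ g ∈ I i, MvPolynomial.aeval v g = 0 := by
  classical
  induction s using Finset.induction_on with
  | empty =>
    exact ⟨K, inferInstance, inferInstance, inferInstance,
      (Algebra.TensorProduct.rid K K (AlgebraicClosure K)).toMulEquiv.isDomain _, by simp⟩
  | insert i s _ ih =>
    obtain ⟨B, _, _, _, _, hB⟩ := ih
    let A := MvPolynomial (Fin (n i)) K ⧸ I i
    have : IsDomain (AlgebraicClosure K ⊗[K] A) :=
      (isDomain_tensorProduct_quotient_iff K _ (I i)).mpr (hI i)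
    refine ⟨A ⊗[K] B, inferInstance, inferInstance, .trans (S := A) inferInstance inferInstance,
      isDomain_tensorProduct_tensorProduct _ K A B, fun j hj ↦ ?_⟩
    obtain rfl | hj := Finset.mem_insert.mp hj
    · let φ : MvPolynomial (Fin (n j)) K →ₐ[K] A ⊗[K] B :=
        Algebra.TensorProduct.includeLeft.comp (Ideal.Quotient.mkₐ K (I j))
      refine ⟨fun x ↦ φ (.X x), fun g hg ↦ ?_⟩
      rw [← MvPolynomial.comp_aeval_apply, MvPolynomial.aeval_X_left_apply]
      have hg0 : Ideal.Quotient.mkₐ K (I j) g = 0 := Ideal.Quotient.eq_zero_iff_mem.mpr hg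
      simp [φ, hg0]
    · obtain ⟨v, hv⟩ := hB j hj
      refine ⟨fun x ↦ Algebra.TensorProduct.includeRight (v x), fun g hg ↦ ?_⟩
      rw [← MvPolynomial.comp_aeval_apply, hv g hg, map_zero]

/-- Finitely many geometrically prime ideals over `K` acquire zeros in an extension field in which
`K` is algebraically closed. -/
theorem exists_field_zero_of_finset {K : Type} [Field K] {ι : Type*} (n : ι → ℕ)
    (I : ∀ i, Ideal (MvPolynomial (Fin (n i)) K)) (hI : ∀ i, (I i).IsGeometricallyPrime)
    (s : Finset ι) :
    ∃ (F : Type) (_ : Field F) (_ : Algebra K F),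
      (∀ x : F, IsAlgebraic K x → ∃ a : K, algebraMap K F a = x) ∧
      ∀ i ∈ s, ∃ v : Fin (n i) → F, ∀ g ∈ I i, MvPolynomial.aeval v g = 0 := by
  obtain ⟨B, _, _, _, _, hB⟩ := exists_finiteType_algebra_zero n I hI s
  have := isDomain_of_isDomain_tensorProduct K (AlgebraicClosure K) B
  refine ⟨FractionRing B, inferInstance, inferInstance,
    mem_range_of_isAlgebraic_fractionRing (AlgebraicClosure K) K B _, fun i hi ↦ ?_⟩
  obtain ⟨v, hv⟩ := hB i hi
  refine ⟨fun x ↦ algebraMap B _ (v x), fun g hg ↦ ?_⟩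
  have := MvPolynomial.aeval_algebraMap_apply (FractionRing B) v g
  rw [hv g hg, map_zero] at this
  exact this

/-- If `K` is algebraically closed in each field `F s`, then it is algebraically closed in every
residue field of the product of the `F s`. -/
theorem mem_range_of_isAlgebraic_pi_quotient {K S : Type*} [Field K] (F : S → Type*)
    [∀ s, Field (F s)] [∀ s, Algebra K (F s)]
    (hF : ∀ s (x : F s), IsAlgebraic K x → ∃ a : K, algebraMap K (F s) a = x)
    (M : Ideal (∀ s, F s)) [M.IsPrime] (x : (∀ s, F s) ⧸ M) (hx : IsAlgebraic K x) :
    ∃ a : K, algebraMap K _ a = x := by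
  classical
  obtain ⟨p, hp, hpx⟩ := hx
  obtain ⟨y, rfl⟩ := Ideal.Quotient.mk_surjective x
  have hpy : Polynomial.aeval y p ∈ M := by
    rw [← Ideal.Quotient.eq_zero_iff_mem, ← hpx]
    exact (Polynomial.aeval_algHom_apply (Ideal.Quotient.mkₐ K M) y p).symm
  have hval (s) : Polynomial.aeval y p s = Polynomial.aeval (y s) p :=
    (Polynomial.aeval_algHom_apply (Pi.evalAlgHom K F s) y p).symm
  let z : ∀ s, F s := ∏ a ∈ p.roots.toFinset, (y - algebraMap K _ a)
  have hz : z = z * (Polynomial.aeval y p)⁻¹ * Polynomial.aeval y p := by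
    ext s
    simp only [Pi.mul_apply, Pi.inv_apply]
    by_cases h0 : Polynomial.aeval y p s = 0
    · have h0' : Polynomial.aeval (y s) p = 0 := hval s ▸ h0
      obtain ⟨a, ha⟩ := hF s (y s) ⟨p, hp, h0'⟩
      have hap : a ∈ p.roots.toFinset := by
        rw [← ha, Polynomial.aeval_algebraMap_apply] at h0'
        simpa [hp] using h0'
      rw [h0, mul_zero]
      simp only [z, Finset.prod_apply]
      exact Finset.prod_eq_zero hap (by simp [ha])
    · rw [mul_assoc, inv_mul_cancel₀ h0, mul_one]
  have hzM : z ∈ M := hz ▸ M.mul_mem_left _ hpy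
  obtain ⟨a, -, ha⟩ := (Ideal.IsPrime.prod_mem_iff).mp hzM
  exact ⟨a, (Ideal.Quotient.eq.mpr ha).symm⟩

/-- All geometrically prime ideals over `K` acquire zeros in a common extension field in which `K`
is algebraically closed. -/
theorem exists_field_zero (K : Type) [Field K] :
    ∃ (F : Type) (_ : Field F) (_ : Algebra K F),
      (∀ x : F, IsAlgebraic K x → ∃ a : K, algebraMap K F a = x) ∧
      ∀ (n : ℕ) (I : Ideal (MvPolynomial (Fin n) K)), I.IsGeometricallyPrime →
        ∃ v : Fin n → F, ∀ g ∈ I, MvPolynomial.aeval v g = 0 := by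
  classical
  let ι := Σ n : ℕ, {I : Ideal (MvPolynomial (Fin n) K) // I.IsGeometricallyPrime}
  choose F _ _ hF hzero using
    exists_field_zero_of_finset (ι := ι) (fun i ↦ i.1) (fun i ↦ i.2.1) (fun i ↦ i.2.2)
  let N : Ideal (∀ s, F s) :=
    { carrier := {x | ∀ᶠ s in Filter.atTop, x s = 0}
      add_mem' := fun {x y} hx hy ↦ by
        filter_upwards [hx, hy] with s h₁ h₂
        simp [h₁, h₂]
      zero_mem' := by simp
      smul_mem' := fun c x hx ↦ by
        filter_upwards [hx] with s h
        simp [h] }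
  have hN : N ≠ ⊤ := by
    rw [Ideal.ne_top_iff_one]
    intro h
    obtain ⟨s, hs⟩ := Filter.Eventually.exists (f := Filter.atTop) h
    exact one_ne_zero hs
  obtain ⟨M, hM, hNM⟩ := Ideal.exists_le_maximal N hN
  refine ⟨(∀ s, F s) ⧸ M, Ideal.Quotient.field M, Ideal.Quotient.algebra K,
    mem_range_of_isAlgebraic_pi_quotient F hF M, fun n I hI ↦ ?_⟩
  let i : ι := ⟨n, I, hI⟩
  let w : Fin n → ∀ s, F s := fun x s ↦ if h : i ∈ s then (hzero s i h).choose x else 0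
  refine ⟨fun x ↦ Ideal.Quotient.mk M (w x), fun g hg ↦ ?_⟩
  refine (MvPolynomial.comp_aeval_apply w (Ideal.Quotient.mkₐ K M) g).symm.trans ?_
  refine Ideal.Quotient.eq_zero_iff_mem.mpr (hNM ?_)
  change ∀ᶠ s in Filter.atTop, _
  filter_upwards [Filter.eventually_ge_atTop {i}] with s hs
  have his : i ∈ s := hs (Finset.mem_singleton_self i)
  refine (MvPolynomial.comp_aeval_apply w (Pi.evalAlgHom K F s) g).trans ?_
  have hw : (fun x ↦ Pi.evalAlgHom K F s (w x)) = (hzero s i his).choose := by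
    ext x
    simp [w, his]
  exact hw ▸ (hzero s i his).choose_spec g hg

/-- The union of an increasing sequence of fields. -/
theorem exists_field_union (K : ℕ → Type) [∀ n, Field (K n)] (f : ∀ n, K n →+* K (n + 1)) :
    ∃ (L : Type) (_ : Field L) (ι : ∀ n, K n →+* L),
      (∀ n, (ι (n + 1)).comp (f n) = ι n) ∧ ∀ x, ∃ n y, ι n y = x := by
  let G : ℕ ⥤ CommRingCat.{0} :=
    Functor.ofSequence (X := fun n ↦ CommRingCat.of (K n)) fun n ↦ CommRingCat.ofHom (f n)
  let ι (n : ℕ) : K n →+* (colimit G : CommRingCat) := (colimit.ι G n).hom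
  have hsurj (x : (colimit G : CommRingCat)) : ∃ n y, ι n y = x :=
    Concrete.colimit_exists_rep G x
  have hfield : IsField (colimit G : CommRingCat) := by
    refine ⟨⟨0, 1, fun h01 ↦ ?_⟩, mul_comm, fun {a} ha ↦ ?_⟩
    · obtain ⟨m, i, j, hij⟩ := Concrete.colimit_exists_of_rep_eq G (0 : G.obj 0) (1 : G.obj 0)
        ((map_zero (ι 0)).trans (h01.trans (map_one (ι 0)).symm))
      have : (0 : K m) = 1 :=
        (map_zero (G.map i).hom).symm.trans (hij.trans (map_one (G.map j).hom))
      exact zero_ne_one this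
    · obtain ⟨n, y, rfl⟩ := hsurj a
      have hy : y ≠ 0 := by rintro rfl; exact ha (map_zero _)
      exact ⟨ι n y⁻¹, by rw [← map_mul, mul_inv_cancel₀ hy, map_one]⟩
  refine ⟨(colimit G : CommRingCat), hfield.toField, ι, fun n ↦ ?_, hsurj⟩
  have := colimit.w G (homOfLE (Nat.le_add_right n 1))
  rw [Functor.ofSequence_map_homOfLE_succ] at this
  exact congrArg CommRingCat.Hom.hom this

section Sequence

variable {K : ℕ → Type*} [∀ n, Field (K n)] {f : ∀ n, K n →+* K (n + 1)} {L : Type*} [Field L]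
  {ι : ∀ n, K n →+* L}

theorem monotone_range_of_comp_eq (hι : ∀ n, (ι (n + 1)).comp (f n) = ι n) :
    Monotone fun n ↦ (ι n).range := by
  refine monotone_nat_of_le_succ fun n ↦ ?_
  rintro _ ⟨x, rfl⟩
  exact ⟨f n x, congr($(hι n) x)⟩

/-- Finitely many polynomials over the union of a sequence of fields are defined over some member
of the sequence. -/
theorem exists_finset_subset_range_map (hι : ∀ n, (ι (n + 1)).comp (f n) = ι n)
    (hsurj : ∀ x, ∃ n y, ι n y = x) {σ : Type*} (s : Finset (MvPolynomial σ L)) :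
    ∃ n, (s : Set (MvPolynomial σ L)) ⊆ Set.range (MvPolynomial.map (ι n)) := by
  classical
  have hc (c : Finset L) : ∃ n, ∀ x ∈ c, x ∈ (ι n).range := by
    induction c using Finset.induction_on with
    | empty => exact ⟨0, by simp⟩
    | insert a c _ ih =>
      obtain ⟨n, hn⟩ := ih
      obtain ⟨m, y, rfl⟩ := hsurj a
      refine ⟨max m n, fun x hx ↦ ?_⟩
      obtain rfl | hx := Finset.mem_insert.mp hx
      · exact monotone_range_of_comp_eq hι (le_max_left m n) ⟨y, rfl⟩
      · exact monotone_range_of_comp_eq hι (le_max_right m n) (hn x hx)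
  obtain ⟨n, hn⟩ := hc (s.biUnion MvPolynomial.coeffs)
  refine ⟨n, fun p hp ↦ ?_⟩
  exact MvPolynomial.mem_range_map_iff_coeffs_subset.mpr fun x hx ↦
    hn x (Finset.mem_biUnion.mpr ⟨p, hp, hx⟩)

theorem exists_mem_range_zero_of_isAlgebraic [Algebra (K 0) L] (hL : algebraMap (K 0) L = ι 0)
    (hι : ∀ n, (ι (n + 1)).comp (f n) = ι n) (hsurj : ∀ x, ∃ n y, ι n y = x)
    (hf : ∀ n (x : K (n + 1)), (∃ p : Polynomial (K n), p ≠ 0 ∧ p.eval₂ (f n) x = 0) →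
      ∃ a, f n a = x)
    (x : L) (hx : IsAlgebraic (K 0) x) : ∃ a, algebraMap (K 0) L a = x := by
  obtain ⟨n, y, rfl⟩ := hsurj x
  induction n with
  | zero => exact ⟨y, by rw [hL]⟩
  | succ n ih =>
    suffices ∃ a, f n a = y by
      obtain ⟨a, rfl⟩ := this
      have ha : ι (n + 1) (f n a) = ι n a := congr($(hι n) a)
      rw [ha] at hx ⊢
      exact ih a hx
    obtain ⟨j, hj⟩ : ∃ j : K 0 →+* K n, (ι n).comp j = ι 0 := by
      clear hx y ih
      induction n with
      | zero => exact ⟨RingHom.id _, by simp⟩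
      | succ n ih =>
        obtain ⟨j, hj⟩ := ih
        exact ⟨(f n).comp j, by rw [← RingHom.comp_assoc, hι, hj]⟩
    obtain ⟨p, hp, hpx⟩ := hx
    refine hf n y ⟨p.map j, (Polynomial.map_ne_zero_iff j.injective).mpr hp,
      (ι (n + 1)).injective ?_⟩
    rw [Polynomial.eval₂_map, Polynomial.hom_eval₂, ← RingHom.comp_assoc, hι, hj, map_zero, ← hpx,
      Polynomial.aeval_def, hL]

end Sequence

/-- Every field is algebraically closed in some extension field over which all geometrically prime
ideals have zeros. -/
theorem exists_field_forall_geometricallyPrime_zero (k : Type) [Field k] :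
    ∃ (L : Type) (_ : Field L) (_ : Algebra k L),
      (∀ x : L, IsAlgebraic k x → ∃ a : k, algebraMap k L a = x) ∧
      ∀ (n : ℕ) (I : Ideal (MvPolynomial (Fin n) L)), I.IsGeometricallyPrime →
        ∃ v : Fin n → L, ∀ g ∈ I, MvPolynomial.aeval v g = 0 := by
  choose F instF instA hF hzero using fun (K : Σ K : Type, Field K) ↦
    letI := K.2; exists_field_zero K.1
  let T : ℕ → Σ K : Type, Field K := fun n ↦ Nat.rec ⟨k, ‹_›⟩ (fun _ K ↦ ⟨F K, instF K⟩) n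
  let instT (n) : Field (T n).1 := (T n).2
  let f (n) : (T n).1 →+* (T (n + 1)).1 :=
    letI := (T n).2; letI := instF (T n); @algebraMap _ _ _ _ (instA (T n))
  obtain ⟨L, _, ι, hι, hsurj⟩ := exists_field_union (fun n ↦ (T n).1) f
  let : Algebra k L := (ι 0).toAlgebra
  refine ⟨L, inferInstance, inferInstance, exists_mem_range_zero_of_isAlgebraic
    (K := fun n ↦ (T n).1) (f := f) rfl hι hsurj fun n x hx ↦ hF (T n) x hx, fun m I hI ↦ ?_⟩
  obtain ⟨s, rfl⟩ := (isNoetherian_def.mp inferInstance I : I.FG)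
  obtain ⟨n, hn⟩ := exists_finset_subset_range_map (K := fun n ↦ (T n).1) hι hsurj s
  obtain ⟨t, ht⟩ := Set.subset_range_iff_exists_image_eq.mp hn
  change (Ideal.span (s : Set (MvPolynomial (Fin m) L))).IsGeometricallyPrime at hI
  rw [← ht, ← Ideal.map_span] at hI
  obtain ⟨v, hv⟩ := hzero (T n) m _ hI.descend
  change Fin m → (T (n + 1)).1 at v
  refine ⟨fun x ↦ ι (n + 1) (v x), fun g hg ↦ ?_⟩
  suffices Ideal.span (s : Set (MvPolynomial (Fin m) L)) ≤
      RingHom.ker (MvPolynomial.aeval (R := L) fun x ↦ ι (n + 1) (v x)) from this hg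
  rw [← ht, Ideal.span_le]
  rintro _ ⟨h, hh, rfl⟩
  have h0 : MvPolynomial.eval₂ (f n) v h = 0 := hv h (Ideal.subset_span hh)
  rw [SetLike.mem_coe, RingHom.mem_ker, MvPolynomial.aeval_def, MvPolynomial.eval₂_map,
    Algebra.algebraMap_self, RingHom.id_comp, ← hι n]
  simpa [MvPolynomial.eval₂_comp_left, Function.comp_def] using congrArg (ι (n + 1)) h0

/-- A finite type algebra which is geometrically a domain has a rational point over a field where
all geometrically prime ideals have zeros. -/
theorem exists_algHom_of_isDomain_tensorProduct {L : Type} [Field L]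
    (hL : ∀ (n : ℕ) (I : Ideal (MvPolynomial (Fin n) L)), I.IsGeometricallyPrime →
      ∃ v : Fin n → L, ∀ g ∈ I, MvPolynomial.aeval v g = 0)
    (A : Type*) [CommRing A] [Algebra L A] [Algebra.FiniteType L A]
    [IsDomain (A ⊗[L] AlgebraicClosure L)] : Nonempty (A →ₐ[L] L) := by
  obtain ⟨n, φ, hφ⟩ := Algebra.FiniteType.iff_quotient_mvPolynomial''.mp ‹Algebra.FiniteType L A›
  let e : (MvPolynomial (Fin n) L ⧸ RingHom.ker φ) ≃ₐ[L] A :=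
    Ideal.quotientKerAlgEquivOfSurjective hφ
  have hI : (RingHom.ker φ).IsGeometricallyPrime := by
    refine (isDomain_tensorProduct_quotient_iff L (AlgebraicClosure L) (RingHom.ker φ)).mp ?_
    exact ((Algebra.TensorProduct.comm L _ _).trans
      (Algebra.TensorProduct.congr e AlgEquiv.refl)).toMulEquiv.isDomain _
  obtain ⟨v, hv⟩ := hL n _ hI
  exact ⟨(Ideal.Quotient.liftₐ _ (MvPolynomial.aeval v) hv).comp e.symm.toAlgHom⟩

/-- A nonempty affine open of a geometrically integral scheme is geometrically integral. -/
theorem isDomain_tensorProduct_of_isOpenImmersion {L A : Type} [Field L] [CommRing A] [Algebra L A]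
    [Nontrivial A] {X : Scheme} (f : X ⟶ Spec (CommRingCat.of L))
    (u : Spec (CommRingCat.of A) ⟶ X) [IsOpenImmersion u]
    (hu : u ≫ f = Spec.map (CommRingCat.ofHom (algebraMap L A))) [IsIntegral (geomFiber L f)] :
    IsDomain (A ⊗[L] AlgebraicClosure L) := by
  let g := Spec.map (CommRingCat.ofHom (algebraMap L (AlgebraicClosure L)))
  let w : pullback (Spec.map (CommRingCat.ofHom (algebraMap L A))) g ⟶ geomFiber L f :=
    pullback.map _ _ f g u (𝟙 _) (𝟙 _) (by simp [hu]) (by simp)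
  have : IsOpenImmersion w := inferInstanceAs (IsOpenImmersion (pullback.map ..))
  let w' := (pullbackSpecIso L A (AlgebraicClosure L)).inv ≫ w
  have : Nontrivial (A ⊗[L] AlgebraicClosure L) := inferInstance
  have : Nonempty (Spec (CommRingCat.of (A ⊗[L] AlgebraicClosure L))) :=
    inferInstanceAs (Nonempty (PrimeSpectrum (A ⊗[L] AlgebraicClosure L)))
  have := isIntegral_of_isOpenImmersion w'
  exact (affine_isIntegral_iff _).mp this

/-- Every field `k` of characteristic zero admits a field extension `L` such that `k` is
algebraically closed in `L` and `L` is pseudo-algebraically closed: every geometrically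
integral `L`-variety has an `L`-rational point. -/
theorem exists_pac_extension (k : Type) [Field k] [CharZero k] :
    ∃ (L : Type) (_ : Field L) (_ : Algebra k L),
      (∀ x : L, IsAlgebraic k x → ∃ a : k, algebraMap k L a = x) ∧
      (∀ (X : Scheme) (f : X ⟶ Spec (CommRingCat.of L)),
        IsSeparated f → LocallyOfFiniteType f → QuasiCompact f →
        GeometricallyIntegral L f →
        ∃ s : Spec (CommRingCat.of L) ⟶ X, s ≫ f = 𝟙 _) := by
  obtain ⟨L, _, _, hk, hL⟩ := exists_field_forall_geometricallyPrime_zero k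
  refine ⟨L, inferInstance, inferInstance, hk, fun X f _ _ _ hX ↦ ?_⟩
  have : IsIntegral (geomFiber L f) := hX
  obtain ⟨y⟩ : Nonempty (geomFiber L f) := inferInstance
  obtain ⟨U, hU, hxU, -⟩ := exists_isAffineOpen_mem_and_subset
    (x := pullback.fst f (Spec.map (CommRingCat.ofHom (algebraMap L (AlgebraicClosure L)))) y)
    (U := ⊤) trivial
  let φ := Spec.preimage (hU.fromSpec ≫ f)
  have hφ : Spec.map φ = hU.fromSpec ≫ f := Spec.map_preimage _
  algebraize [φ.hom]
  have : Nonempty U := ⟨_, hxU⟩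
  have : Nontrivial Γ(X, U) := inferInstance
  have : Algebra.FiniteType L Γ(X, U) := by
    have h : LocallyOfFiniteType (Spec.map φ) := hφ ▸ inferInstance
    exact (HasRingHomProperty.Spec_iff (P := @LocallyOfFiniteType)).mp h
  have := isDomain_tensorProduct_of_isOpenImmersion (A := Γ(X, U)) f hU.fromSpec hφ.symm
  obtain ⟨ψ⟩ := exists_algHom_of_isDomain_tensorProduct hL Γ(X, U)
  refine ⟨Spec.map (CommRingCat.ofHom ψ.toRingHom) ≫ hU.fromSpec, ?_⟩
  rw [Category.assoc, ← hφ, ← Spec.map_comp, ← Spec.map_id]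
  congr 1
  ext x
  exact ψ.commutes x
end

section
/- (Tsen) Let F be an algebraically closed field and let K be a finitely generated field extension of F of transcendence degree 1 (a function field of one variable over F). Then K is a C₁ field: every homogeneous polynomial of degree d ≥ 1 in n variables over K with n > d has a nontrivial zero in Kⁿ. -/
/-- A field `K` is a `C_i` field if every homogeneous polynomial over `K` of degree `d ≥ 1`
in `n` variables with `n > d ^ i` has a nontrivial zero in `Kⁿ`. -/
def IsCField (i : ℕ) (K : Type*) [Field K] : Prop :=
  ∀ (n d : ℕ), 1 ≤ d → d ^ i < n → ∀ φ : MvPolynomial (Fin n) K,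
    φ.IsHomogeneous d → ∃ x : Fin n → K, x ≠ 0 ∧ MvPolynomial.eval x φ = 0

namespace MvPolynomial

/-- The ideal of polynomials vanishing at the origin has height at least the number of variables. -/
theorem card_le_height_vanishingIdeal_zero (F σ : Type*) [Field F] [Fintype σ] :
    (Fintype.card σ : ℕ∞) ≤ (vanishingIdeal F {(0 : σ → F)}).height := by
  classical
  let P (s : Finset σ) : Ideal (MvPolynomial σ F) :=
    RingHom.ker (aeval (R := F) fun i => if i ∈ s then (0 : MvPolynomial σ F) else X i)
  have hP (s : Finset σ) : (P s).IsPrime := RingHom.ker_isPrime _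
  have key (s : Finset σ) : (s.card : ℕ∞) ≤ (P s).height := by
    induction s using Finset.induction_on with
    | empty => simp
    | insert a s ha ih =>
      have hlt : P s < P (insert a s) := by
        refine lt_of_le_of_ne (fun p hp => ?_) fun h => ?_
        · have hcomp : aeval (R := F)
              (fun i => if i ∈ insert a s then (0 : MvPolynomial σ F) else X i) =
              (aeval fun i => if i ∈ insert a s then (0 : MvPolynomial σ F) else X i).comp
                (aeval fun i => if i ∈ s then (0 : MvPolynomial σ F) else X i) := by
            ext1 i
            by_cases hi : i ∈ s <;> simp [hi]
          rw [RingHom.mem_ker] at hp ⊢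
          rw [hcomp, AlgHom.comp_apply, hp, map_zero]
        · have hX : (X a : MvPolynomial σ F) ∈ P (insert a s) := by simp [P]
          rw [← h] at hX
          simp [P, ha] at hX
      rw [Finset.card_insert_of_notMem ha]
      push_cast
      exact (add_le_add_left ih 1).trans (Ideal.height_add_one_le_of_lt_of_isPrime hlt)
  refine (key Finset.univ).trans (Ideal.height_mono fun p hp => ?_)
  rw [mem_vanishingIdeal_singleton_iff]
  have h0 : aeval (R := F) (0 : σ → F) = (aeval (0 : σ → F)).comp
      (aeval fun i => if i ∈ Finset.univ then (0 : MvPolynomial σ F) else X i) := by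
    ext1 i
    simp
  rw [h0, AlgHom.comp_apply, (RingHom.mem_ker).1 hp, map_zero]

/-- Over an algebraically closed field, fewer polynomials than variables, all vanishing at the
origin, have another common zero. -/
theorem exists_ne_zero_forall_eval_eq_zero {F σ ι : Type*} [Field F] [IsAlgClosed F] [Fintype σ]
    [Fintype ι] (f : ι → MvPolynomial σ F) (hcard : Fintype.card ι < Fintype.card σ)
    (hf : ∀ i, eval 0 (f i) = 0) : ∃ x : σ → F, x ≠ 0 ∧ ∀ i, eval x (f i) = 0 := by
  by_contra! hne
  set I := Ideal.span (Set.range f) with hI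
  have hzero : zeroLocus F I = {0} := by
    rw [zeroLocus_span]
    ext x
    simp only [Set.forall_mem_range, Set.mem_ofPred_eq, Set.mem_singleton_iff, aeval_eq_eval]
    refine ⟨fun h => ?_, fun h i => by simpa [h] using hf i⟩
    by_contra hx
    obtain ⟨i, hi⟩ := hne x hx
    exact hi (h i)
  have hrad : I.radical = vanishingIdeal F {(0 : σ → F)} := by
    rw [← hzero, vanishingIdeal_zeroLocus_eq_radical]
  have hmin : vanishingIdeal F {(0 : σ → F)} ∈ I.minimalPrimes := by
    rw [← Ideal.radical_minimalPrimes, hrad, Ideal.minimalPrimes_eq_subsingleton_self]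
    rfl
  have h := (card_le_height_vanishingIdeal_zero F σ).trans
    (Ideal.height_le_card_of_mem_minimalPrimes_span (Set.finite_range f) hmin)
  have h' : (Set.range f).ncard ≤ Fintype.card ι := by
    rw [← Set.image_univ, ← Nat.card_eq_fintype_card, ← Set.ncard_univ]
    exact Set.ncard_image_le
  exact absurd (Nat.cast_le.1 h) (by omega)

/-- A polynomial over `K` vanishing at the origin whose coefficients span an `F`-subspace of
dimension less than the number of variables has a nontrivial zero over `F`. -/
theorem exists_ne_zero_eval_algebraMap_eq_zero {F K σ : Type*} [Field F] [IsAlgClosed F] [Field K]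
    [Algebra F K] [Fintype σ] (W : Submodule F K) [FiniteDimensional F W]
    (hcard : Module.finrank F W < Fintype.card σ) (p : MvPolynomial σ K) (hp : p ∈ coeffsIn σ W)
    (hp0 : eval 0 p = 0) :
    ∃ a : σ → F, a ≠ 0 ∧ eval (fun i => algebraMap F K (a i)) p = 0 := by
  obtain ⟨π, hπ⟩ := W.subtype.exists_leftInverse_of_injective W.ker_subtype
  let b := Module.finBasis F W
  let coord (l : Fin (Module.finrank F W)) : K →ₗ[F] F := b.coord l ∘ₗ π
  let f (l : Fin (Module.finrank F W)) : MvPolynomial σ F :=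
    ∑ m ∈ p.support, monomial m (coord l (coeff m p))
  have hf (l) (a : σ → F) : eval a (f l) = coord l (eval (fun i => algebraMap F K (a i)) p) := by
    rw [eval_eq (X := fun i => algebraMap F K (a i)), map_sum, map_sum]
    refine Finset.sum_congr rfl fun m _ => ?_
    rw [eval_monomial, Finsupp.prod_fintype _ _ (by simp)]
    have : coeff m p * ∏ i ∈ m.support, algebraMap F K (a i) ^ m i =
        (∏ i, a i ^ m i) • coeff m p := by
      rw [Algebra.smul_def, mul_comm, map_prod]
      congr 1
      simp only [map_pow]
      exact Finset.prod_subset (Finset.subset_univ _) fun i _ hi => by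
        simp [Finsupp.notMem_support_iff.1 hi]
    rw [this, map_smul, smul_eq_mul, mul_comm]
  obtain ⟨a, ha, hfa⟩ := exists_ne_zero_forall_eval_eq_zero f (by simpa using hcard) fun l => by
    rw [hf]
    convert map_zero (coord l)
    simpa [← Pi.zero_def] using hp0
  refine ⟨a, ha, ?_⟩
  set y := eval (fun i => algebraMap F K (a i)) p with hy
  have hyW : y ∈ W := by
    rw [hy, eval_eq]
    refine W.sum_mem fun m _ => ?_
    simp_rw [← map_pow, ← map_prod]
    rw [mul_comm, ← Algebra.smul_def]
    exact W.smul_mem _ (hp m)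
  have hπy : π y = ⟨y, hyW⟩ := LinearMap.congr_fun hπ ⟨y, hyW⟩
  have : (⟨y, hyW⟩ : W) = 0 := by
    rw [← b.forall_coord_eq_zero_iff]
    intro l
    rw [← hπy, ← hfa l, hf]
    rfl
  exact congrArg Subtype.val this

/-- Substituting polynomials with coefficients in `L` into a form of degree `d` with coefficients in
`M` yields a polynomial with coefficients in `M * L ^ d`. -/
theorem IsHomogeneous.aeval_mem_coeffsIn {F K σ τ : Type*} [Field F] [Field K] [Algebra F K]
    {M L : Submodule F K} {d : ℕ} {p : MvPolynomial σ K} (hp : p.IsHomogeneous d)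
    (hpM : p ∈ coeffsIn σ M) {g : σ → MvPolynomial τ K} (hg : ∀ i, g i ∈ coeffsIn τ L) :
    MvPolynomial.aeval g p ∈ coeffsIn τ (M * L ^ d) := by
  rw [aeval_def, eval₂_eq]
  refine Submodule.sum_mem _ fun m hm => ?_
  rw [coeffsIn_mul]
  refine Submodule.mul_mem_mul (C_mem_coeffsIn.2 (hpM m)) (le_coeffsIn_pow ?_)
  have hd : ∑ i ∈ m.support, m i = d := by
    rw [← hp (mem_support_iff.1 hm), Finsupp.weight_apply, Finsupp.sum]
    simp
  rw [← hd]
  clear hd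
  induction m.support using Finset.cons_induction with
  | empty => simpa using ⟨1, by simp⟩
  | cons i s hi ih =>
    rw [Finset.prod_cons, Finset.sum_cons, pow_add]
    exact Submodule.mul_mem_mul (Submodule.pow_mem_pow _ (hg i) _) ih

end MvPolynomial

/-- The `F`-span of `1, t, …, t ^ c`. -/
def powSpan (F : Type*) {K : Type*} [Field F] [Field K] [Algebra F K] (t : K) (c : ℕ) :
    Submodule F K :=
  Submodule.span F ((t ^ ·) '' Set.Iic c)

section

variable {F K : Type*} [Field F] [Field K] [Algebra F K] (t : K)

theorem pow_mem_powSpan {k c : ℕ} (h : k ≤ c) : t ^ k ∈ powSpan F t c :=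
  Submodule.subset_span ⟨k, h, rfl⟩

theorem powSpan_mul_le (a b : ℕ) : powSpan F t a * powSpan F t b ≤ powSpan F t (a + b) := by
  rw [powSpan, powSpan, Submodule.span_mul_span, Submodule.span_le]
  rintro _ ⟨_, ⟨i, hi, rfl⟩, _, ⟨j, hj, rfl⟩, rfl⟩
  simp only [← pow_add]
  exact pow_mem_powSpan t (add_le_add hi hj)

theorem powSpan_pow_le (s d : ℕ) : powSpan F t s ^ d ≤ powSpan F t (d * s) := by
  induction d with
  | zero =>
    rw [pow_zero, Submodule.one_le]
    simpa using pow_mem_powSpan (F := F) t (le_refl 0)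
  | succ d ih =>
    rw [pow_succ, Nat.succ_mul]
    exact (mul_le_mul_left ih _).trans (powSpan_mul_le t _ _)

theorem aeval_mem_powSpan {p : Polynomial F} {c : ℕ} (h : p.natDegree ≤ c) :
    Polynomial.aeval t p ∈ powSpan F t c := by
  rw [Polynomial.aeval_eq_sum_range' (Nat.lt_succ_of_le h)]
  exact Submodule.sum_mem _ fun k hk => Submodule.smul_mem _ _
    (pow_mem_powSpan t (Nat.lt_succ_iff.1 (Finset.mem_range.1 hk)))

theorem powSpan_mul_span_range {ι : Type*} (e : ι → K) (c : ℕ) :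
    powSpan F t c * Submodule.span F (Set.range e) =
      Submodule.span F (Set.range fun q : Fin (c + 1) × ι => t ^ (q.1 : ℕ) * e q.2) := by
  rw [powSpan, Submodule.span_mul_span]
  congr 1
  ext x
  simp only [Set.mem_mul, Set.exists_mem_image, Set.mem_range, Prod.exists,
    Set.mem_Iic]
  constructor
  · rintro ⟨k, hk, _, ⟨j, rfl⟩, rfl⟩
    exact ⟨⟨k, Nat.lt_succ_of_le hk⟩, j, rfl⟩
  · rintro ⟨k, j, rfl⟩
    exact ⟨k, Nat.lt_succ_iff.1 k.2, _, ⟨j, rfl⟩, rfl⟩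

/-- A finite-dimensional `F`-subspace of `K` can be scaled into the span of the `t ^ k * e j`
with `k ≤ c`, for some `c`, when `e` is a basis of `K` over `F(t)`. -/
theorem exists_mul_mem_powSpan_mul {ι : Type*} [Fintype ι]
    (e : Module.Basis ι (IntermediateField.adjoin F {t}) K) (Y : Submodule F K) (hY : Y.FG) :
    ∃ h : K, h ≠ 0 ∧ ∃ c : ℕ, ∀ y ∈ Y, h * y ∈ powSpan F t c * Submodule.span F (Set.range e) := by
  classical
  open scoped IntermediateField.algebraAdjoinAdjoin in
  obtain ⟨S, rfl⟩ := hY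
  obtain ⟨b, hb⟩ := IsLocalization.exist_integer_multiples
    (nonZeroDivisors (Algebra.adjoin F {t})) (S ×ˢ (Finset.univ : Finset ι))
    fun q => e.repr q.1 q.2
  have hpoly : ∀ q : K × ι, ∃ p : Polynomial F, q ∈ S ×ˢ (Finset.univ : Finset ι) →
      Polynomial.aeval t p = (b : Algebra.adjoin F {t}) * (e.repr q.1 q.2 : K) := by
    intro q
    by_cases hq : q ∈ S ×ˢ (Finset.univ : Finset ι)
    · obtain ⟨⟨r, hr⟩, hrq⟩ := hb q hq
      rw [Algebra.adjoin_singleton_eq_range_aeval] at hr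
      obtain ⟨p, hp⟩ := hr
      exact ⟨p, fun _ => hp.trans (congrArg Subtype.val hrq)⟩
    · exact ⟨0, fun h => absurd h hq⟩
  choose p hp using hpoly
  refine ⟨(b : Algebra.adjoin F {t}), fun h => nonZeroDivisors.coe_ne_zero b (Subtype.ext h),
    (S ×ˢ (Finset.univ : Finset ι)).sup fun q => (p q).natDegree, fun y hy => ?_⟩
  induction hy using Submodule.span_induction with
  | zero => simp
  | add x y _ _ hx hy => rw [mul_add]; exact Submodule.add_mem _ hx hy
  | smul a x _ hx => rw [mul_smul_comm]; exact Submodule.smul_mem _ _ hx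
  | mem y hy =>
    rw [← e.sum_repr y, Finset.mul_sum]
    refine Submodule.sum_mem _ fun j _ => ?_
    have hq : (y, j) ∈ S ×ˢ (Finset.univ : Finset ι) := by simpa using hy
    rw [Algebra.smul_def, ← mul_assoc]
    refine Submodule.mul_mem_mul ?_ (Submodule.subset_span ⟨j, rfl⟩)
    exact hp _ hq ▸ aeval_mem_powSpan t (Finset.le_sup (f := fun q => (p q).natDegree) hq)

end

/-- If `t` is transcendental and `e` is a basis of `K` over `F(t)`, the `t ^ k * e j` are linearly
independent over `F`. -/
theorem linearIndependent_pow_mul_basis {F K ι : Type*} [Field F] [Field K] [Algebra F K] {t : K}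
    (ht : Transcendental F t) (e : Module.Basis ι (IntermediateField.adjoin F {t}) K) (s : ℕ) :
    LinearIndependent F fun q : Fin s × ι => t ^ (q.1 : ℕ) * e q.2 := by
  have hpow : LinearIndependent F fun k : ℕ => t ^ k := by
    have := (Polynomial.basisMonomials F).linearIndependent.map'
      (Polynomial.aeval t).toLinearMap
      (LinearMap.ker_eq_bot.2 (transcendental_iff_injective.1 ht))
    simpa [Function.comp_def] using this
  have hgen : LinearIndependent F fun k : Fin s =>
      IntermediateField.AdjoinSimple.gen F t ^ (k : ℕ) := by
    refine LinearIndependent.of_comp (IntermediateField.val _).toLinearMap ?_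
    simpa [Function.comp_def] using hpow.comp _ Fin.val_injective
  simpa [Algebra.smul_def] using linearIndependent_smul hgen e.linearIndependent

/-- **Tsen's theorem**: a function field of one variable (a finitely generated field extension
of transcendence degree 1) over an algebraically closed field `F` is a `C₁` field. -/
theorem tsen (F K : Type*) [Field F] [IsAlgClosed F] [Field K] [Algebra F K]
    (hfg : (⊤ : IntermediateField F K).FG)
    (htr : ∃ x : K, IsTranscendenceBasis F (fun _ : Unit => x)) :
    IsCField 1 K := by

  classical
  obtain ⟨t, ht⟩ := htr
  have htrans : Transcendental F t := (algebraicIndependent_unique_type_iff).1 ht.1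
  have : Algebra.IsAlgebraic (IntermediateField.adjoin F {t}) K := by
    convert! ht.isAlgebraic_field <;> simp
  have : Algebra.EssFiniteType F K := IntermediateField.fg_top_iff.1 hfg
  have : Algebra.EssFiniteType (IntermediateField.adjoin F {t}) K := .of_comp F _ K
  have : Module.Finite (IntermediateField.adjoin F {t}) K :=
    Algebra.finite_of_essFiniteType_of_isAlgebraic
  let e := Module.finBasis (IntermediateField.adjoin F {t}) K
  set m := Module.finrank (IntermediateField.adjoin F {t}) K
  have hm : 0 < m := Module.finrank_pos
  intro n d hd hn φ hφ
  rw [pow_one] at hn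
  set E := Submodule.span F (Set.range e)
  set M := Submodule.span F (φ.coeffs : Set K)
  have hE : E.FG := Submodule.fg_span (Set.finite_range e)
  have hM : M.FG := Submodule.fg_span φ.coeffs.finite_toSet
  have hφM : φ ∈ MvPolynomial.coeffsIn (Fin n) M :=
    MvPolynomial.mem_coeffsIn_iff_coeffs_subset.2 Submodule.subset_span
  obtain ⟨h, hh, c, hc⟩ := exists_mul_mem_powSpan_mul t e (M * E ^ d) (hM.mul (hE.pow d))
  set W := powSpan F t (d * c + c) * E
  let g (i : Fin n) : MvPolynomial (Fin n × Fin (c + 1) × Fin m) K :=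
    ∑ q : Fin (c + 1) × Fin m,
      MvPolynomial.C (t ^ (q.1 : ℕ) * e q.2) * MvPolynomial.X (i, q)
  have hg (i) : g i ∈ MvPolynomial.coeffsIn _ (powSpan F t c * E) :=
    Submodule.sum_mem _ fun q _ => MvPolynomial.mul_X_mem_coeffsIn.2 <|
      MvPolynomial.C_mem_coeffsIn.2 <| Submodule.mul_mem_mul
        (pow_mem_powSpan t (Nat.lt_succ_iff.1 q.1.2)) (Submodule.subset_span ⟨q.2, rfl⟩)
  have hle : Submodule.span F {h} * (M * (powSpan F t c * E) ^ d) ≤ W := by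
    have h1 : Submodule.span F {h} * (M * E ^ d) ≤ powSpan F t c * E := by
      rw [Submodule.span_singleton_mul]
      rintro _ ⟨y, hy, rfl⟩
      exact hc y hy
    calc Submodule.span F {h} * (M * (powSpan F t c * E) ^ d)
        = powSpan F t c ^ d * (Submodule.span F {h} * (M * E ^ d)) := by rw [mul_pow]; ring
      _ ≤ powSpan F t (d * c) * (powSpan F t c * E) := mul_le_mul' (powSpan_pow_le t c d) h1
      _ ≤ W := by
        rw [← mul_assoc]
        exact mul_le_mul' (powSpan_mul_le t _ _) le_rfl
  have hW : W = Submodule.span F (Set.range _) := powSpan_mul_span_range t e _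
  have : FiniteDimensional F W := by
    rw [hW]
    exact FiniteDimensional.span_of_finite F (Set.finite_range _)
  have hrank : Module.finrank F W < Fintype.card (Fin n × Fin (c + 1) × Fin m) := by
    have h1 : Module.finrank F W ≤ (d * c + c + 1) * m := by
      rw [hW]
      refine (finrank_range_le_card (R := F) _).trans_eq ?_
      simp
    refine h1.trans_lt ?_
    simp only [Fintype.card_prod, Fintype.card_fin, ← mul_assoc]
    refine Nat.mul_lt_mul_of_pos_right ?_ hm
    nlinarith
  have heval (a : Fin n × Fin (c + 1) × Fin m → K) :
      MvPolynomial.eval a (MvPolynomial.aeval g φ) =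
        MvPolynomial.eval (fun i => ∑ q, t ^ (q.1 : ℕ) * e q.2 * a (i, q)) φ := by
    rw [← MvPolynomial.aeval_eq_eval, MvPolynomial.comp_aeval_apply]
    simp [g]
  obtain ⟨a, ha, hzero⟩ := MvPolynomial.exists_ne_zero_eval_algebraMap_eq_zero W hrank
    (MvPolynomial.C h * MvPolynomial.aeval g φ)
    (fun k => hle <| by
      rw [MvPolynomial.coeff_C_mul]
      exact Submodule.mul_mem_mul (Submodule.mem_span_singleton_self h)
        (hφ.aeval_mem_coeffsIn hφM hg k))
    (by
      rw [map_mul, heval]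
      have : MvPolynomial.eval (0 : Fin n → K) φ = 0 := by
        rw [MvPolynomial.eval_zero]
        exact hφ.coeff_eq_zero (by simp; omega)
      simpa [← Pi.zero_def] using Or.inr this)
  rw [map_mul, MvPolynomial.eval_C, heval] at hzero
  refine ⟨_, fun hx => ha ?_, (mul_eq_zero.1 hzero).resolve_left hh⟩
  ext ⟨i, q⟩
  refine Fintype.linearIndependent_iff.1 (linearIndependent_pow_mul_basis htrans e (c + 1))
    (fun q => a (i, q)) ?_ q
  simpa [Algebra.smul_def, mul_comm] using congrFun hx i
end

section
/- (Lang–Nagata) Let i ≥ 0 and let K be a C_i field. Then: (a) every algebraic field extension of K is a C_i field; (b) the field K(t) of rational functions in one variable over K is a C_{i+1} field; (c) more generally, for every integer m ≥ 0, every field extension of K of transcendence degree m is a C_{i+m} field. -/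
open MvPolynomial in
/-- There is a form of degree `D` over `K` in variables indexed by `σ` whose only zero is `0`. -/
def HasAnisotropicForm (K σ : Type*) [Field K] (D : ℕ) : Prop :=
  ∃ φ : MvPolynomial σ K, φ.IsHomogeneous D ∧ ∀ x : σ → K, eval x φ = 0 → x = 0

namespace HasAnisotropicForm

open MvPolynomial

variable {K σ τ κ : Type*} [Field K] {d D : ℕ}

theorem of_injective (h : HasAnisotropicForm K σ D) {f : τ → σ} (hf : f.Injective) :
    HasAnisotropicForm K τ D := by
  obtain ⟨φ, hφ, h0⟩ := h
  refine ⟨aeval (Function.extend f X 0 : σ → MvPolynomial τ K) φ, ?_, fun x hx ↦ ?_⟩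
  · have := hφ.aeval (Function.extend f X 0 : σ → MvPolynomial τ K) (n := 1) fun s ↦ ?_
    · simpa using this
    · by_cases hs : ∃ t, f t = s
      · obtain ⟨t, rfl⟩ := hs
        rw [hf.extend_apply]
        exact isHomogeneous_X _ _
      · rw [Function.extend_apply' _ _ _ hs]
        exact isHomogeneous_zero _ _ _
  · have hx' : eval (Function.extend f x 0) φ = 0 := by
      rw [← hx, ← bind₁, ← coe_aeval_eq_eval, ← coe_aeval_eq_eval, RingHom.coe_coe,
        RingHom.coe_coe, aeval_bind₁]
      congr 2
      funext s
      by_cases hs : ∃ t, f t = s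
      · obtain ⟨t, rfl⟩ := hs
        simp [hf.extend_apply]
      · simp [Function.extend_apply' _ _ _ hs]
    funext t
    simpa [hf.extend_apply] using congrFun (h0 _ hx') (f t)

theorem of_card_le [Fintype σ] [Fintype τ] (h : HasAnisotropicForm K σ D)
    (hc : Fintype.card τ ≤ Fintype.card σ) : HasAnisotropicForm K τ D := by
  obtain ⟨f⟩ := Function.Embedding.nonempty_of_card_le hc
  exact h.of_injective f.injective

/-- Substituting copies of an anisotropic system into an anisotropic form gives an
anisotropic form. -/
theorem comp_system (h : HasAnisotropicForm K (τ × κ) D) (F : τ → MvPolynomial σ K)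
    (hF : ∀ t, (F t).IsHomogeneous d) (hF0 : ∀ x, (∀ t, eval x (F t) = 0) → x = 0) :
    HasAnisotropicForm K (σ × κ) (d * D) := by
  obtain ⟨φ, hφ, h0⟩ := h
  refine ⟨bind₁ (fun p ↦ rename (fun s ↦ (s, p.2)) (F p.1)) φ,
    hφ.aeval _ fun p ↦ (hF p.1).rename_isHomogeneous, fun x hx ↦ ?_⟩
  rw [← coe_aeval_eq_eval, RingHom.coe_coe, aeval_bind₁] at hx
  have key := h0 _ hx
  funext ⟨s, k⟩
  refine congrFun (hF0 (fun s ↦ x (s, k)) fun t ↦ ?_) s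
  have := congrFun key (t, k)
  simpa [aeval_rename, Function.comp_def, aeval_eq_eval] using this

theorem mul [Fintype σ] [Fintype τ] {E : ℕ} (hσ : HasAnisotropicForm K σ D)
    (hτ : HasAnisotropicForm K τ E) : HasAnisotropicForm K (σ × τ) (D * E) := by
  obtain ⟨φ, hφ, h0⟩ := hσ
  exact (hτ.of_card_le (τ := Unit × τ) (by simp)).comp_system (fun _ ↦ φ) (fun _ ↦ hφ)
    fun x hx ↦ h0 x (hx ())

theorem pow {N : ℕ} (h : HasAnisotropicForm K (Fin N) D) (a : ℕ) :
    HasAnisotropicForm K (Fin (N ^ a)) (D ^ a) := by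
  induction a with
  | zero =>
    have h1 : HasAnisotropicForm K (Fin 1) 1 := ⟨X 0, isHomogeneous_X _ _, fun x hx ↦ by
      funext j
      simpa [Subsingleton.elim j 0] using hx⟩
    exact pow_zero D ▸ h1.of_card_le (by simp)
  | succ a ih =>
    rw [pow_succ D]
    exact (ih.mul h).of_card_le (by simp [pow_succ])

/-- The homogenization of a polynomial without roots is anisotropic. -/
theorem of_forall_eval_ne_zero (p : Polynomial K) (hp : ∀ x, p.eval x ≠ 0) :
    HasAnisotropicForm K (Fin 2) p.natDegree := by
  refine ⟨∑ k ∈ Finset.range (p.natDegree + 1),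
    C (p.coeff k) * X 0 ^ k * X 1 ^ (p.natDegree - k), ?_, fun x hx ↦ ?_⟩
  · refine IsHomogeneous.sum _ _ _ fun k hk ↦ ?_
    have := ((isHomogeneous_C_mul_X_pow (p.coeff k) (0 : Fin 2) k).mul
      (isHomogeneous_X_pow (R := K) (1 : Fin 2) (p.natDegree - k)))
    rwa [Nat.add_sub_cancel' (by simpa [Nat.lt_succ_iff] using hk)] at this
  · simp only [map_sum, map_mul, eval_C, map_pow, eval_X] at hx
    have hp0 : p ≠ 0 := by rintro rfl; simpa using hp 0
    by_cases h1 : x 1 = 0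
    · rw [Finset.sum_range_succ, Finset.sum_eq_zero, zero_add, h1] at hx
      · have h00 : x 0 = 0 := by
          simp [hp0] at hx
          exact hx.1
        funext j
        fin_cases j <;> simp [h00, h1]
      · intro k hk
        rw [h1, zero_pow, mul_zero]
        have := Finset.mem_range.1 hk
        omega
    · refine absurd ?_ (hp (x 0 / x 1))
      rw [Polynomial.eval_eq_sum_range]
      refine (mul_eq_zero.1 (?_ : _ * x 1 ^ p.natDegree = 0)).resolve_right (pow_ne_zero _ h1)
      rw [Finset.sum_mul, ← hx]
      refine Finset.sum_congr rfl fun k hk ↦ ?_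
      have hk' : k ≤ p.natDegree := by simpa [Nat.lt_succ_iff] using hk
      rw [← Nat.sub_add_cancel hk', pow_add (x 1), Nat.sub_add_cancel hk', div_pow]
      field_simp

end HasAnisotropicForm

theorem IsCField.card_le_of_hasAnisotropicForm {i D : ℕ} {K σ : Type*} [Field K] [Fintype σ]
    (hK : IsCField i K) (hD : 1 ≤ D) (h : HasAnisotropicForm K σ D) :
    Fintype.card σ ≤ D ^ i := by
  by_contra! hlt
  obtain ⟨φ, hφ, h0⟩ := h.of_card_le (τ := Fin (Fintype.card σ)) (by simp)
  obtain ⟨x, hx, hx0⟩ := hK _ D hD hlt φ hφ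
  exact hx (h0 x hx0)

/-- An anisotropic system of `r` forms of degree `d` in `n > r * d ^ i` variables would, by
iterated substitution, turn a large anisotropic form into forms violating the `C_i` condition. -/
theorem IsCField.exists_common_zero_of_not_isAlgClosed {i d : ℕ} {K σ τ : Type*} [Field K]
    [Fintype σ] [Fintype τ] (hK : IsCField i K) (hcl : ¬ IsAlgClosed K) (hd : 1 ≤ d)
    (hc : Fintype.card τ * d ^ i < Fintype.card σ) (F : τ → MvPolynomial σ K)
    (hF : ∀ t, (F t).IsHomogeneous d) :
    ∃ x : σ → K, x ≠ 0 ∧ ∀ t, MvPolynomial.eval x (F t) = 0 := by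
  by_contra! hcon
  have hF0 : ∀ x, (∀ t, MvPolynomial.eval x (F t) = 0) → x = 0 := fun x hx ↦ by
    by_contra hne
    obtain ⟨t, ht⟩ := hcon x hne
    exact ht (hx t)
  set r := Fintype.card τ with hr
  have hr0 : 0 < r := by
    by_contra! h0
    have : IsEmpty τ := Fintype.card_eq_zero_iff.1 (by omega)
    obtain ⟨s⟩ : Nonempty σ := Fintype.card_pos_iff.1 (by omega)
    exact one_ne_zero (congrFun (hF0 1 fun t ↦ isEmptyElim t) s)
  obtain ⟨p, hp1, hp⟩ : ∃ p : Polynomial K, 1 ≤ p.natDegree ∧ ∀ x, p.eval x ≠ 0 := by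
    by_contra! h
    exact hcl (IsAlgClosed.of_exists_root K fun p _ hirr ↦ h p hirr.natDegree_pos)
  obtain ⟨D, hD, hA⟩ : ∃ D, 1 ≤ D ∧ HasAnisotropicForm K (Fin (r * r)) D :=
    ⟨_, Nat.one_le_pow _ _ hp1,
      ((HasAnisotropicForm.of_forall_eval_ne_zero p hp).pow (r * r)).of_card_le
        (by simpa using Nat.lt_two_pow_self.le)⟩
  have hdi : 1 ≤ d ^ i := Nat.one_le_pow _ _ hd
  have key : ∀ j : ℕ, ∃ k, (2 * r * d ^ i + 1) ^ j * r ≤ (2 * r) ^ j * k ∧ r ≤ k ∧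
      HasAnisotropicForm K (Fin (r * k)) (d ^ j * D) := by
    intro j
    induction j with
    | zero => exact ⟨r, by simp, le_rfl, by simpa using hA⟩
    | succ j ih =>
      obtain ⟨k, hk, hrk, hAk⟩ := ih
      refine ⟨d ^ i * k + k / r, ?_, ?_, ?_⟩
      · have h1 : (2 * r * d ^ i + 1) * k ≤ 2 * r * (d ^ i * k + k / r) := by
          have h2 := Nat.div_add_mod k r
          have h3 := Nat.mod_lt k hr0
          have h4 : 1 ≤ k / r := (Nat.one_le_div_iff hr0).2 hrk
          nlinarith
        calc (2 * r * d ^ i + 1) ^ (j + 1) * r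
            = (2 * r * d ^ i + 1) * ((2 * r * d ^ i + 1) ^ j * r) := by ring
          _ ≤ (2 * r * d ^ i + 1) * ((2 * r) ^ j * k) := by gcongr
          _ = (2 * r) ^ j * ((2 * r * d ^ i + 1) * k) := by ring
          _ ≤ (2 * r) ^ j * (2 * r * (d ^ i * k + k / r)) := by gcongr
          _ = _ := by ring
      · nlinarith [Nat.zero_le (k / r)]
      · rw [pow_succ', mul_assoc]
        refine ((hAk.of_card_le (τ := τ × Fin k) (by simp [hr])).comp_system F hF
          hF0).of_card_le ?_
        have h2 := Nat.mul_div_le k r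
        simp only [Fintype.card_fin, Fintype.card_prod]
        nlinarith
  have bound : ∀ j : ℕ, (2 * r * d ^ i + 1) ^ j ≤ (2 * r * d ^ i) ^ j * D ^ i := by
    intro j
    obtain ⟨k, hk, -, hAk⟩ := key j
    have hle := hK.card_le_of_hasAnisotropicForm (Nat.mul_pos (Nat.pow_pos hd) hD) hAk
    rw [Fintype.card_fin] at hle
    calc (2 * r * d ^ i + 1) ^ j ≤ (2 * r * d ^ i + 1) ^ j * r := Nat.le_mul_of_pos_right _ hr0
      _ ≤ (2 * r) ^ j * k := hk
      _ ≤ (2 * r) ^ j * (r * k) := by gcongr; exact Nat.le_mul_of_pos_left _ hr0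
      _ ≤ (2 * r) ^ j * (d ^ j * D) ^ i := by gcongr
      _ = _ := by rw [mul_pow _ D, mul_pow (2 * r), ← pow_mul, ← pow_mul, mul_comm i j]; ring
  set B := 2 * r * d ^ i with hB
  have hB0 : (0 : ℝ) < B := by exact_mod_cast (by positivity : 0 < B)
  have h1 := one_add_mul_le_pow (a := 1 / (B : ℝ))
    (by linarith [one_div_pos.2 hB0]) (B * D ^ i)
  have h2 : (1 + 1 / (B : ℝ)) ^ (B * D ^ i) ≤ (D : ℝ) ^ i := by
    rw [one_add_div hB0.ne', div_pow, div_le_iff₀ (by positivity), mul_comm (_ ^ i)]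
    exact_mod_cast bound (B * D ^ i)
  have h3 : ((B * D ^ i : ℕ) : ℝ) * (1 / (B : ℝ)) = (D : ℝ) ^ i := by
    push_cast
    field_simp
  linarith

section

open MvPolynomial
open scoped IntermediateField.algebraAdjoinAdjoin

theorem MvPolynomial.le_height_vanishingIdeal_zero (K : Type*) [Field K] (n : ℕ) :
    (n : ℕ∞) ≤ (vanishingIdeal K {(0 : Fin n → K)}).height := by
  let f : ℕ → MvPolynomial (Fin n) K →ₐ[K] MvPolynomial (Fin n) K :=
    fun k ↦ aeval fun j ↦ if j.1 < k then 0 else X j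
  have hprime : ∀ k, (RingHom.ker (f k)).IsPrime := fun k ↦ RingHom.ker_isPrime _
  have hcomp : ∀ k, (f (k + 1)).comp (f k) = f (k + 1) := by
    intro k
    ext1 j
    by_cases h : j.1 < k
    · simp [f, h, h.le]
    · simp [f, h]
  have hlt : ∀ k < n, RingHom.ker (f k) < RingHom.ker (f (k + 1)) := by
    intro k hk
    refine lt_of_le_of_ne (fun p hp ↦ ?_) fun heq ↦ ?_
    · rw [RingHom.mem_ker] at hp ⊢
      rw [← hcomp, AlgHom.comp_apply, hp, map_zero]
    · have hmem : (X ⟨k, hk⟩ : MvPolynomial (Fin n) K) ∈ RingHom.ker (f (k + 1)) := by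
        simp [RingHom.mem_ker, f]
      rw [← heq, RingHom.mem_ker] at hmem
      simp [f] at hmem
  have hheight : ∀ k ≤ n, (k : ℕ∞) ≤ (RingHom.ker (f k)).height := by
    intro k
    induction k with
    | zero => simp
    | succ k ih =>
      intro hk
      have := Ideal.height_add_one_le_of_lt_of_isPrime (hlt k hk)
      push_cast
      exact (add_le_add_left (ih (by omega)) 1).trans this
  convert hheight n le_rfl using 2
  ext p
  have : f n p = C (eval 0 p) := by
    have h : f n = (Algebra.ofId K (MvPolynomial (Fin n) K)).comp (aeval (0 : Fin n → K)) := by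
      ext1 j
      simp [f]
    rw [h]
    simp [Algebra.ofId_apply, aeval_eq_eval, algebraMap_eq]
  rw [RingHom.mem_ker, this, mem_vanishingIdeal_singleton_iff, aeval_eq_eval]
  simp

theorem IsAlgClosed.exists_common_zero_fin {d n : ℕ} {K τ : Type*} [Field K] [IsAlgClosed K]
    [Fintype τ] (hd : 1 ≤ d) (hc : Fintype.card τ < n) (F : τ → MvPolynomial (Fin n) K)
    (hF : ∀ t, (F t).IsHomogeneous d) :
    ∃ x : Fin n → K, x ≠ 0 ∧ ∀ t, MvPolynomial.eval x (F t) = 0 := by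
  by_contra! hcon
  have hzero : zeroLocus K (Ideal.span (Set.range F)) = {0} := by
    ext x
    simp only [zeroLocus_span, Set.mem_ofPred_eq, Set.forall_mem_range, Set.mem_singleton_iff,
      aeval_eq_eval]
    constructor
    · intro hx
      by_contra hne
      obtain ⟨t, ht⟩ := hcon x hne
      exact ht (hx t)
    · rintro rfl t
      rw [eval_zero, constantCoeff_eq]
      exact (hF t).coeff_eq_zero (by simp; omega)
  have hrad := vanishingIdeal_zeroLocus_eq_radical (K := K) (Ideal.span (Set.range F))
  rw [hzero] at hrad
  have hmax : (vanishingIdeal K {(0 : Fin n → K)}).IsMaximal :=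
    isMaximal_iff_eq_vanishingIdeal_singleton.2 ⟨0, rfl⟩
  have hmin : vanishingIdeal K {(0 : Fin n → K)} ∈ (Ideal.span (Set.range F)).minimalPrimes := by
    rw [← Ideal.radical_minimalPrimes, ← hrad]
    have := hmax.isPrime
    simp [Ideal.minimalPrimes_eq_subsingleton_self]
  have h1 := (le_height_vanishingIdeal_zero K n).trans
    (Ideal.height_le_card_of_mem_minimalPrimes_span (Set.finite_range F) hmin)
  have h2 : (Set.range F).ncard ≤ Fintype.card τ := by
    rw [← Set.image_univ, ← Nat.card_eq_fintype_card, ← Set.ncard_univ]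
    exact Set.ncard_image_le
  have h3 : n ≤ (Set.range F).ncard := by exact_mod_cast h1
  omega

/-- Over an algebraically closed field, fewer forms than variables have a common nontrivial
zero: otherwise, by the Nullstellensatz, the ideal of the origin would be minimal over the ideal
they generate, against Krull's height theorem. -/
theorem IsAlgClosed.exists_common_zero {d : ℕ} {K σ τ : Type*} [Field K] [IsAlgClosed K]
    [Fintype σ] [Fintype τ] (hd : 1 ≤ d) (hc : Fintype.card τ < Fintype.card σ)
    (F : τ → MvPolynomial σ K) (hF : ∀ t, (F t).IsHomogeneous d) :
    ∃ x : σ → K, x ≠ 0 ∧ ∀ t, MvPolynomial.eval x (F t) = 0 := by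
  let e := Fintype.equivFin σ
  obtain ⟨x, hx, h⟩ := IsAlgClosed.exists_common_zero_fin hd hc (fun t ↦ rename e (F t))
    fun t ↦ (hF t).rename_isHomogeneous
  refine ⟨x ∘ e, fun h0 ↦ hx ?_, fun t ↦ by simpa [eval_rename] using h t⟩
  funext j
  simpa using congrFun h0 (e.symm j)

/-- **Nagata**: over a `C_i` field, `r` forms of degree `d` in more than `r * d ^ i` variables
have a common nontrivial zero. -/
theorem IsCField.exists_common_zero {i d : ℕ} {K σ τ : Type*} [Field K]
    [Fintype σ] [Fintype τ] (hK : IsCField i K) (hd : 1 ≤ d)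
    (hc : Fintype.card τ * d ^ i < Fintype.card σ) (F : τ → MvPolynomial σ K)
    (hF : ∀ t, (F t).IsHomogeneous d) :
    ∃ x : σ → K, x ≠ 0 ∧ ∀ t, MvPolynomial.eval x (F t) = 0 := by
  by_cases hcl : IsAlgClosed K
  · exact IsAlgClosed.exists_common_zero hd
      ((Nat.le_mul_of_pos_right _ (Nat.pow_pos hd)).trans_lt hc) F hF
  · exact hK.exists_common_zero_of_not_isAlgClosed hcl hd hc F hF

/-- Applying a linear functional to the coefficients of a form over a `K`-algebra. -/
theorem MvPolynomial.IsHomogeneous.exists_eval_eq_linearMap {K R σ : Type*} [Field K] [CommRing R]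
    [Algebra K R] [Fintype σ] {d : ℕ} {ψ : MvPolynomial σ R} (hψ : ψ.IsHomogeneous d)
    (l : R →ₗ[K] K) : ∃ χ : MvPolynomial σ K, χ.IsHomogeneous d ∧
      ∀ x : σ → K, eval x χ = l (eval (fun s ↦ algebraMap K R (x s)) ψ) := by
  refine ⟨∑ m ∈ ψ.support, monomial m (l (ψ.coeff m)), ?_, fun x ↦ ?_⟩
  · refine IsHomogeneous.sum _ _ _ fun m hm ↦ isHomogeneous_monomial _ ?_
    by_contra hne
    exact mem_support_iff.1 hm (hψ.coeff_eq_zero hne)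
  · rw [map_sum, eval_eq', map_sum]
    refine Finset.sum_congr rfl fun m _ ↦ ?_
    rw [eval_monomial, Finsupp.prod_fintype _ _ (by simp)]
    simp only [← map_pow, ← map_prod]
    rw [mul_comm (coeff m ψ), ← Algebra.smul_def, map_smul, smul_eq_mul, mul_comm]

/-- A form over a `K`-algebra `R` can be made to vanish under few linear functionals at a
nontrivial combination of sufficiently many vectors. -/
theorem IsCField.exists_linearMap_eval_eq_zero {i d : ℕ} {K R σ κ τ : Type*} [Field K] [CommRing R]
    [Algebra K R] [Fintype σ] [Fintype κ] [Fintype τ] (hK : IsCField i K) (hd : 1 ≤ d)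
    {φ : MvPolynomial σ R} (hφ : φ.IsHomogeneous d) (v : κ → R) (l : τ → R →ₗ[K] K)
    (hc : Fintype.card τ * d ^ i < Fintype.card σ * Fintype.card κ) :
    ∃ x : σ → κ → K, x ≠ 0 ∧ ∀ t, l t (eval (fun s ↦ ∑ k, x s k • v k) φ) = 0 := by
  let ψ : MvPolynomial (σ × κ) R := bind₁ (fun s ↦ ∑ k, C (v k) * X (s, k)) φ
  have hψ : ψ.IsHomogeneous d := by
    have := hφ.aeval (fun s ↦ ∑ k, C (v k) * X (s, k) : σ → MvPolynomial (σ × κ) R) (n := 1)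
      fun s ↦ IsHomogeneous.sum _ _ _ fun k _ ↦ isHomogeneous_C_mul_X _ _
    rwa [one_mul] at this
  choose χ hχ hχl using fun t ↦ hψ.exists_eval_eq_linearMap (l t)
  obtain ⟨x, hx, hx0⟩ := hK.exists_common_zero hd (by simpa using hc) χ hχ
  refine ⟨fun s k ↦ x (s, k), fun h0 ↦ hx ?_, fun t ↦ ?_⟩
  · funext ⟨s, k⟩
    exact congrFun (congrFun h0 s) k
  · rw [← hx0 t, hχl, ← coe_aeval_eq_eval, ← coe_aeval_eq_eval, RingHom.coe_coe,
      RingHom.coe_coe, aeval_bind₁]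
    simp [Algebra.smul_def, mul_comm]

theorem IsCField.of_finiteDimensional {i : ℕ} {K L : Type*} [Field K] [Field L] [Algebra K L]
    [FiniteDimensional K L] (hK : IsCField i K) : IsCField i L := by
  intro n d hd hn φ hφ
  let b := Module.finBasis K L
  obtain ⟨x, hx, hx0⟩ := hK.exists_linearMap_eval_eq_zero hd hφ b b.coord (by
    have := Module.finrank_pos (R := K) (M := L)
    simp only [Fintype.card_fin]
    nlinarith)
  refine ⟨_, fun h0 ↦ hx ?_, b.ext_elem fun t ↦ by simpa using hx0 t⟩
  funext s k
  exact Fintype.linearIndependent_iff.1 b.linearIndependent _ (congrFun h0 s) k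

theorem IsCField.of_isAlgebraic {i : ℕ} {K L : Type*} [Field K] [Field L] [Algebra K L]
    [Algebra.IsAlgebraic K L] (hK : IsCField i K) : IsCField i L := by
  intro n d hd hn φ hφ
  let M := IntermediateField.adjoin K (φ.coeffs : Set L)
  have : FiniteDimensional K M := IntermediateField.finiteDimensional_adjoin
    fun x _ ↦ Algebra.IsIntegral.isIntegral x
  obtain ⟨ψ, hψ⟩ : ∃ ψ : MvPolynomial (Fin n) M, map (algebraMap M L) ψ = φ := by
    refine mem_range_map_iff_coeffs_subset.2 fun c hc ↦ ?_
    exact ⟨⟨c, IntermediateField.subset_adjoin K _ hc⟩, rfl⟩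
  have hψd : ψ.IsHomogeneous d := .of_map (algebraMap M L).injective (hψ ▸ hφ)
  obtain ⟨x, hx, hx0⟩ := (hK.of_finiteDimensional (L := M)) n d hd hn ψ hψd
  refine ⟨algebraMap M L ∘ x, fun h0 ↦ hx ?_, ?_⟩
  · funext j
    exact (algebraMap M L).injective (by simpa using congrFun h0 j)
  · rw [← hψ, eval_map, ← aeval_def, aeval_algebraMap_apply, aeval_eq_eval, hx0, map_zero]

theorem IsCField.of_ringEquiv {i : ℕ} {K L : Type*} [Field K] [Field L] (e : K ≃+* L)
    (hK : IsCField i K) : IsCField i L := by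
  let _ : Algebra K L := e.toRingHom.toAlgebra
  have : Algebra.IsAlgebraic K L := ⟨fun x ↦ by
    simpa [RingHom.algebraMap_toAlgebra] using isAlgebraic_algebraMap (R := K) (A := L) (e.symm x)⟩
  exact hK.of_isAlgebraic

theorem Polynomial.natDegree_mvPolynomial_eval_le {R σ : Type*} [CommRing R] [Fintype σ] {d s E : ℕ}
    {φ : MvPolynomial σ (Polynomial R)} (hφ : φ.IsHomogeneous d)
    (hE : ∀ m, (φ.coeff m).natDegree ≤ E) {y : σ → Polynomial R} (hy : ∀ j, (y j).natDegree ≤ s) :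
    (MvPolynomial.eval y φ).natDegree ≤ E + d * s := by
  rw [eval_eq']
  refine Polynomial.natDegree_sum_le_of_forall_le _ _ fun m hm ↦ ?_
  refine Polynomial.natDegree_mul_le.trans (add_le_add (hE m) ?_)
  refine (Polynomial.natDegree_prod_le _ _).trans ?_
  rw [hφ.degree_eq_sum_deg_support hm, ← Finsupp.degree_apply, Finsupp.degree_eq_sum, Finset.sum_mul]
  exact Finset.sum_le_sum fun j _ ↦ Polynomial.natDegree_pow_le.trans (by gcongr; exact hy j)

theorem IsCField.exists_polynomial_zero {i n d : ℕ} {K : Type*} [Field K] (hK : IsCField i K)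
    (hd : 1 ≤ d) (hn : d ^ (i + 1) < n) {φ : MvPolynomial (Fin n) (Polynomial K)}
    (hφ : φ.IsHomogeneous d) :
    ∃ y : Fin n → Polynomial K, y ≠ 0 ∧ eval y φ = 0 := by
  obtain ⟨E, hE⟩ : ∃ E, ∀ m, (φ.coeff m).natDegree ≤ E := by
    refine ⟨φ.support.sup fun m ↦ (φ.coeff m).natDegree, fun m ↦ ?_⟩
    by_cases hm : m ∈ φ.support
    · exact Finset.le_sup (f := fun m ↦ (φ.coeff m).natDegree) hm
    · simp [notMem_support_iff.1 hm]
  let s := (E + 1) * d ^ i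
  obtain ⟨x, hx, hx0⟩ := hK.exists_linearMap_eval_eq_zero hd hφ
    (fun k : Fin (s + 1) ↦ (Polynomial.X : Polynomial K) ^ (k : ℕ))
    (fun t : Fin (E + d * s + 1) ↦ Polynomial.lcoeff K t) (by
      simp only [Fintype.card_fin]
      calc (E + d * s + 1) * d ^ i = d ^ (i + 1) * s + s := by simp only [s]; ring
        _ < (d ^ (i + 1) + 1) * (s + 1) := by rw [add_mul, mul_add]; omega
        _ ≤ n * (s + 1) := Nat.mul_le_mul_right _ hn)
  refine ⟨fun j ↦ ∑ k, x j k • Polynomial.X ^ (k : ℕ), fun h0 ↦ hx ?_, ?_⟩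
  · funext j k
    have := congrArg (Polynomial.coeff · k) (congrFun h0 j)
    simpa [Polynomial.finsetSum_coeff, Polynomial.coeff_X_pow, Fin.val_inj] using this
  · ext t
    by_cases ht : t < E + d * s + 1
    · simpa using hx0 ⟨t, ht⟩
    · refine Polynomial.coeff_eq_zero_of_natDegree_lt (lt_of_le_of_lt
        (Polynomial.natDegree_mvPolynomial_eval_le hφ hE (s := s) fun j ↦ ?_) (by omega))
      refine Polynomial.natDegree_sum_le_of_forall_le _ _ fun k _ ↦ ?_
      refine (Polynomial.natDegree_smul_le _ _).trans ?_
      rw [Polynomial.natDegree_X_pow]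
      omega

theorem IsCField.ratFunc {i : ℕ} {K : Type*} [Field K] (hK : IsCField i K) :
    IsCField (i + 1) (RatFunc K) := by
  intro n d hd hn φ hφ
  obtain ⟨c, hc⟩ := IsLocalization.exist_integer_multiples_of_finset
    (nonZeroDivisors (Polynomial K)) φ.coeffs
  have hc0 : algebraMap (Polynomial K) (RatFunc K) c ≠ 0 :=
    IsFractionRing.to_map_ne_zero_of_mem_nonZeroDivisors c.2
  obtain ⟨ψ, hψ⟩ : ∃ ψ : MvPolynomial (Fin n) (Polynomial K),
      map (algebraMap (Polynomial K) (RatFunc K)) ψ = C (algebraMap _ _ c.1) * φ := by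
    refine mem_range_map_iff_coeffs_subset.2 fun a ha ↦ ?_
    obtain ⟨m, hm, rfl⟩ := mem_coeffs_iff.1 ha
    rw [coeff_C_mul]
    rw [mem_support_iff, coeff_C_mul] at hm
    obtain ⟨b, hb⟩ := hc _ (coeff_mem_coeffs m (right_ne_zero_of_mul hm))
    exact ⟨b, by rw [hb, Algebra.smul_def]⟩
  have hinj := IsFractionRing.injective (Polynomial K) (RatFunc K)
  obtain ⟨y, hy, hy0⟩ := hK.exists_polynomial_zero hd hn
    (.of_map hinj (hψ ▸ hφ.C_mul _) : ψ.IsHomogeneous d)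
  refine ⟨algebraMap _ _ ∘ y, fun h0 ↦ hy ?_, ?_⟩
  · funext j
    exact hinj (by simpa using congrFun h0 j)
  · have h : eval (algebraMap (Polynomial K) (RatFunc K) ∘ y)
        (C (algebraMap _ _ c.1) * φ) = 0 := by
      rw [← hψ, eval_map, ← aeval_def, aeval_algebraMap_apply, aeval_eq_eval, hy0, map_zero]
    rw [map_mul, eval_C] at h
    exact (mul_eq_zero.1 h).resolve_left hc0

theorem IsCField.adjoin_range {i : ℕ} {K L : Type*} [Field K] [Field L] [Algebra K L]
    (hK : IsCField i K) (m : ℕ) (x : Fin m → L) (hx : AlgebraicIndependent K x) :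
    IsCField (i + m) (IntermediateField.adjoin K (Set.range x)) := by
  induction m with
  | zero =>
    rw [Set.range_eq_empty, IntermediateField.adjoin_empty]
    exact hK.of_ringEquiv (IntermediateField.botEquiv K L).symm.toRingEquiv
  | succ m ih =>
    let y : Fin m → L := x ∘ Fin.castSucc
    have hF := ih y (hx.comp _ (Fin.castSucc_injective m))
    have himage : x '' {Fin.last m}ᶜ = Set.range y := by
      ext z
      simp [y, Fin.exists_fin_succ', Fin.castSucc_ne_last]
    have htr : Transcendental (Algebra.adjoin K (Set.range y)) (x (Fin.last m)) := by
      rw [← himage]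
      exact hx.transcendental_adjoin (by simp)
    have htr' : Transcendental (IntermediateField.adjoin K (Set.range y)) (x (Fin.last m)) :=
      fun h ↦ htr ((IsFractionRing.isAlgebraic_iff _ _ _).2 h)
    have h := hF.ratFunc.of_ringEquiv
      (RatFunc.algEquivOfTranscendental (x (Fin.last m)) htr').toRingEquiv
    have hrange : Set.range x = Set.range y ∪ {x (Fin.last m)} := by
      ext z
      simp [y, Fin.exists_fin_succ', eq_comm, or_comm]
    rw [hrange, ← IntermediateField.adjoin_adjoin_left]
    exact h

end

/-- **Lang–Nagata**: if `K` is a `C_i` field, then (a) every algebraic field extension of `K`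
is `C_i`; (b) the rational function field `K(t)` is `C_{i+1}`; (c) more generally, every field
extension of `K` of transcendence degree `m` is `C_{i+m}`. -/
theorem lang_nagata (i : ℕ) (K : Type*) [Field K] (hK : IsCField i K) :
    (∀ (L : Type*) [Field L] [Algebra K L], Algebra.IsAlgebraic K L → IsCField i L) ∧
    (IsCField (i + 1) (RatFunc K)) ∧
    (∀ (m : ℕ) (L : Type*) [Field L] [Algebra K L],
      (∃ x : Fin m → L, IsTranscendenceBasis K x) → IsCField (i + m) L) := by
  refine ⟨fun L _ _ _ ↦ hK.of_isAlgebraic, hK.ratFunc, fun m L _ _ ⟨x, hx⟩ ↦ ?_⟩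
  have := hx.isAlgebraic_field
  exact (hK.adjoin_range m x hx.1).of_isAlgebraic
end

section
/- (Chevalley–Warning–Ax) Let 𝔽 be a finite field with q elements, and let Φ be a homogeneous polynomial of degree d ≥ 1 in n+1 variables over 𝔽, with n ≥ d. Then the number of points of the projective hypersurface Φ = 0 in ℙⁿ(𝔽) is congruent to 1 modulo q; in particular this hypersurface has an 𝔽-rational point. -/
open MvPolynomial

/-- The base `p` digit sum of `p * k + r`, for a digit `r`. -/
lemma Nat.sum_digits_mul_add {p : ℕ} (hp : 1 < p) (k : ℕ) {r : ℕ} (hr : r < p) :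
    (p.digits (p * k + r)).sum = r + (p.digits k).sum := by
  rcases Nat.eq_zero_or_pos (p * k + r) with h | h
  · obtain ⟨hk, rfl⟩ := Nat.add_eq_zero_iff.1 h
    obtain rfl : k = 0 := by rcases Nat.mul_eq_zero.1 hk with h | h <;> omega
    simp
  · rw [Nat.digits_def' hp h, Nat.mul_add_mod, Nat.mod_eq_of_lt hr, Nat.mul_add_div (by omega),
      Nat.div_eq_of_lt hr]
    simp

lemma Nat.sum_digits_pow_sub_one {p : ℕ} (hp : 1 < p) (m : ℕ) :
    (p.digits (p ^ m - 1)).sum = m * (p - 1) := by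
  induction m with
  | zero => simp
  | succ m ih =>
    have h : p ^ (m + 1) - 1 = p * (p ^ m - 1) + (p - 1) := by
      have : 1 ≤ p ^ m := Nat.one_le_pow _ _ (by omega)
      have : p ≤ p * p ^ m := Nat.le_mul_of_pos_right _ (by omega)
      rw [pow_succ', Nat.mul_sub]
      omega
    rw [h, Nat.sum_digits_mul_add hp _ (by omega), ih]
    ring

lemma Nat.sum_digits_pow_mul {p : ℕ} (hp : 1 < p) (m k : ℕ) :
    (p.digits (p ^ m * k)).sum = (p.digits k).sum := by
  induction m with
  | zero => simp
  | succ m ih =>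
    have := Nat.sum_digits_mul_add hp (p ^ m * k) (r := 0) (by omega)
    rw [pow_succ', mul_assoc]
    simpa [ih] using this

/-- A sum over a full period does not depend on where it starts. -/
lemma Function.Periodic.sum_range_add {M : Type*} [AddCommMonoid M] {f : ℕ → M} {m : ℕ}
    (hf : Function.Periodic f m) (c : ℕ) :
    ∑ j ∈ Finset.range m, f (j + c) = ∑ j ∈ Finset.range m, f j := by
  induction c with
  | zero => simp
  | succ c ih =>
    rw [← ih]
    cases m with
    | zero => simp
    | succ m =>
      rw [Finset.sum_range_succ, Finset.sum_range_succ']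
      congr 1
      · exact Finset.sum_congr rfl fun j _ => by congr 1; ring
      · rw [← hf (0 + c)]; congr 1; ring

/-- The cyclic rotations of the base `p` digits of `k`, folded modulo `p ^ m - 1`. -/
lemma Nat.exists_digit_rotation {p m : ℕ} (hp : 1 < p) (k : ℕ) :
    ∃ ρ : ℕ → ℕ, (∀ j, ρ j ≡ p ^ j * k [MOD p ^ m - 1]) ∧ (0 < k → ∀ j, 0 < ρ j) ∧
      ∀ c, (p - 1) * ∑ j ∈ Finset.range m, ρ (j + c) = (p ^ m - 1) * (p.digits k).sum := by
  induction k using Nat.strong_induction_on with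
  | _ k ih =>
    rcases Nat.eq_zero_or_pos k with rfl | hk
    · exact ⟨fun _ => 0, by simp [Nat.ModEq.refl], by simp, by simp⟩
    obtain ⟨ρ, hmod, hpos, hsum⟩ := ih (k / p) (Nat.div_lt_self hk hp)
    refine ⟨fun j => k % p * p ^ (j % m) + ρ (j + 1), fun j => ?_, fun _ j => ?_, fun c => ?_⟩
    · have hone : p ^ m ≡ 1 [MOD p ^ m - 1] :=
        ((Nat.modEq_iff_dvd' (Nat.one_le_pow _ _ (by omega))).2 dvd_rfl).symm
      have hred : p ^ (j % m) ≡ p ^ j [MOD p ^ m - 1] := by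
        conv_rhs => rw [← Nat.mod_add_div j m, pow_add, pow_mul]
        simpa using ((hone.pow (j / m)).mul_left (p ^ (j % m))).symm
      refine ((hred.mul_left (k % p)).add (hmod (j + 1))).trans (congrArg (· % (p ^ m - 1)) ?_)
      conv_rhs => rw [← Nat.mod_add_div k p]
      ring
    · rcases Nat.eq_zero_or_pos (k / p) with h | h
      · have : 0 < k % p := by
          have := Nat.mod_add_div k p
          rw [h] at this
          omega
        positivity
      · exact Nat.add_pos_right _ (hpos h _)
    · have hper : Function.Periodic (fun j => p ^ (j % m)) m := fun j => by simp
      have hgeom : (p - 1) * ∑ j ∈ Finset.range m, p ^ ((j + c) % m) = p ^ m - 1 := by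
        rw [hper.sum_range_add c, Finset.sum_congr rfl fun j hj => by
          rw [Nat.mod_eq_of_lt (Finset.mem_range.1 hj)]]
        have := geom_sum_mul_add (p - 1) m
        rw [Nat.sub_add_cancel hp.le] at this
        rw [mul_comm]
        exact Nat.eq_sub_of_add_eq this
      have hdig := Nat.sum_digits_mul_add hp (k / p) (Nat.mod_lt k (by omega : 0 < p))
      rw [Nat.div_add_mod] at hdig
      have hs := hsum (c + 1)
      rw [hdig, Finset.sum_add_distrib, ← Finset.mul_sum, mul_add, mul_left_comm, hgeom]
      simp only [add_assoc]
      rw [hs]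
      ring

/-- Legendre's formula for multinomial coefficients. -/
lemma Nat.sub_one_mul_padicValNat_multinomial {ι : Type*} {p : ℕ} [Fact p.Prime] (s : Finset ι)
    (k : ι → ℕ) :
    (p - 1) * padicValNat p (Nat.multinomial s k) + (p.digits (∑ i ∈ s, k i)).sum =
      ∑ i ∈ s, (p.digits (k i)).sum := by
  have hp : p.Prime := Fact.out
  have hfac (n : ℕ) : (p - 1) * (n.factorial).factorization p + (p.digits n).sum = n := by
    rw [Nat.factorization_def _ hp, sub_one_mul_padicValNat_factorial]
    exact Nat.sub_add_cancel (Nat.digit_sum_le p n)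
  have hspec := congrArg (fun n => n.factorization p) (Nat.multinomial_spec s k)
  have hprod : ∏ i ∈ s, (k i).factorial ≠ 0 :=
    Finset.prod_ne_zero_iff.2 fun i _ => Nat.factorial_ne_zero _
  have hmul : Nat.multinomial s k ≠ 0 := (Nat.multinomial_pos s k).ne'
  simp only [Nat.factorization_mul hprod hmul, Finsupp.add_apply,
    Nat.factorization_prod_apply (fun i _ => Nat.factorial_ne_zero (k i))] at hspec
  have hsum := hfac (∑ i ∈ s, k i)
  rw [← hspec, mul_add, Finset.mul_sum] at hsum
  have hk : ∑ i ∈ s, k i = ∑ i ∈ s, (p - 1) * ((k i).factorial).factorization p +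
      ∑ i ∈ s, (p.digits (k i)).sum := by
    rw [← Finset.sum_add_distrib]
    exact Finset.sum_congr rfl fun i _ => (hfac _).symm
  rw [← Nat.factorization_def _ hp]
  omega

/-- If all exponents of `∏ u ∈ s, (X ^ u) ^ k u` are positive multiples of `p ^ m - 1`, where the
`u` have degree `d` less than the number of variables, and `p ^ m - 1` divides `∑ u ∈ s, k u`,
then the `k u` have many base `p` digits in total. -/
lemma two_mul_le_sum_sum_digits {σ : Type*} [Fintype σ] {p m d : ℕ} (hp : 1 < p) (hm : m ≠ 0)
    (hd : d < Fintype.card σ) (s : Finset (σ →₀ ℕ)) (hs : ∀ u ∈ s, ∑ x, u x = d)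
    (k : (σ →₀ ℕ) → ℕ) (hk : p ^ m - 1 ∣ ∑ u ∈ s, k u)
    (hdvd : ∀ x, p ^ m - 1 ∣ ∑ u ∈ s, k u * u x) (hpos : ∀ x, 0 < ∑ u ∈ s, k u * u x) :
    2 * (m * (p - 1)) ≤ ∑ u ∈ s, (p.digits (k u)).sum := by
  choose ρ hmod hρ hsum using fun u => Nat.exists_digit_rotation (m := m) hp (k u)
  have hq : 0 < p ^ m - 1 := Nat.sub_pos_of_lt (Nat.one_lt_pow hm hp)
  have hcoord (j : ℕ) (x : σ) : p ^ m - 1 ≤ ∑ u ∈ s, ρ u j * u x := by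
    refine Nat.le_of_dvd ?_ ?_
    · obtain ⟨u, hu, hux⟩ := Finset.exists_ne_zero_of_sum_ne_zero (hpos x).ne'
      obtain ⟨hku, hux⟩ := Nat.mul_ne_zero_iff.1 hux
      exact Finset.sum_pos' (fun _ _ => Nat.zero_le _)
        ⟨u, hu, Nat.mul_pos (hρ u (Nat.pos_of_ne_zero hku) j) (Nat.pos_of_ne_zero hux)⟩
    · have h : ∑ u ∈ s, ρ u j * u x ≡ ∑ u ∈ s, p ^ j * k u * u x [MOD p ^ m - 1] :=
        Nat.ModEq.sum fun u _ => (hmod u j).mul_right _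
      refine (h.dvd_iff dvd_rfl).2 ?_
      simp_rw [mul_assoc, ← Finset.mul_sum]
      exact (hdvd x).mul_left _
  have hrot (j : ℕ) : 2 * (p ^ m - 1) ≤ ∑ u ∈ s, ρ u j := by
    have h : ∑ u ∈ s, ρ u j ≡ ∑ u ∈ s, p ^ j * k u [MOD p ^ m - 1] :=
      Nat.ModEq.sum fun u _ => hmod u j
    rw [← Finset.mul_sum] at h
    obtain ⟨c, hc⟩ := (h.dvd_iff dvd_rfl).2 (hk.mul_left _)
    have htotal : Fintype.card σ * (p ^ m - 1) ≤ (∑ u ∈ s, ρ u j) * d := by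
      calc Fintype.card σ * (p ^ m - 1) = ∑ _x : σ, (p ^ m - 1) := by simp
        _ ≤ ∑ x, ∑ u ∈ s, ρ u j * u x := Finset.sum_le_sum fun x _ => hcoord j x
        _ = (∑ u ∈ s, ρ u j) * d := by
          rw [Finset.sum_comm, Finset.sum_mul]
          exact Finset.sum_congr rfl fun u hu => by rw [← Finset.mul_sum, hs u hu]
    have hc2 : 2 ≤ c := by
      by_contra! hlt
      rw [hc] at htotal
      have : (p ^ m - 1) * c * d ≤ (p ^ m - 1) * d :=
        Nat.mul_le_mul_right _ (by nlinarith)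
      nlinarith
    rw [hc, mul_comm]
    exact Nat.mul_le_mul_left _ hc2
  refine Nat.le_of_mul_le_mul_left ?_ hq
  calc (p ^ m - 1) * (2 * (m * (p - 1)))
      = (p - 1) * ∑ _j ∈ Finset.range m, 2 * (p ^ m - 1) := by simp; ring
    _ ≤ (p - 1) * ∑ j ∈ Finset.range m, ∑ u ∈ s, ρ u j :=
        Nat.mul_le_mul_left _ (Finset.sum_le_sum fun j _ => hrot j)
    _ = (p ^ m - 1) * ∑ u ∈ s, (p.digits (k u)).sum := by
        rw [Finset.sum_comm, Finset.mul_sum, Finset.mul_sum]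
        exact Finset.sum_congr rfl fun u _ => by simpa using hsum u 0

section WittVector

variable {p : ℕ} [Fact p.Prime]

section CommRing

variable {R σ : Type*} [CommRing R] [Fintype σ]

@[simp]
lemma WittVector.constantCoeff_teichmuller (a : R) :
    WittVector.constantCoeff (WittVector.teichmuller p a) = a := by
  rw [WittVector.constantCoeff_apply, WittVector.teichmuller_coeff_zero]

/-- The value at the Teichmüller representative of `t` of the coefficientwise Teichmüller lift
of `Φ`. -/
noncomputable def teichmullerEval (p : ℕ) [Fact p.Prime] (Φ : MvPolynomial σ R) (t : σ → R) :
    WittVector p R :=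
  ∑ u ∈ Φ.support,
    WittVector.teichmuller p (Φ.coeff u) * ∏ x, WittVector.teichmuller p (t x) ^ u x

lemma constantCoeff_teichmullerEval (Φ : MvPolynomial σ R) (t : σ → R) :
    WittVector.constantCoeff (teichmullerEval p Φ t) = eval t Φ := by
  simp [teichmullerEval, eval_eq', -WittVector.constantCoeff_apply]

end CommRing

variable {K : Type*} [Field K] [CharP K p]

lemma WittVector.pow_dvd_natCast_iff {m n : ℕ} :
    (p : WittVector p K) ^ m ∣ (n : WittVector p K) ↔ p ^ m ∣ n := by
  refine ⟨fun h => ?_, fun h => by exact_mod_cast Nat.cast_dvd_cast h⟩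
  induction m generalizing n with
  | zero => simp
  | succ m ih =>
    obtain ⟨n, rfl⟩ : p ∣ n := by
      rw [← CharP.cast_eq_zero_iff K p]
      simpa using map_dvd (WittVector.constantCoeff (p := p) (R := K))
        ((dvd_pow_self _ m.succ_ne_zero).trans h)
    rw [pow_succ', Nat.cast_mul, mul_dvd_mul_iff_left (WittVector.p_nonzero p K)] at h
    rw [pow_succ']
    exact Nat.mul_dvd_mul_left p (ih h)

lemma WittVector.p_dvd_iff_constantCoeff_eq_zero [PerfectRing K p] (x : WittVector p K) :
    (p : WittVector p K) ∣ x ↔ WittVector.constantCoeff x = 0 := by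
  rw [← Ideal.mem_span_singleton, WittVector.mem_span_p_iff_coeff_zero_eq_zero,
    WittVector.constantCoeff_apply]

variable [Fintype K]

/-- Power sums of Teichmüller representatives are divisible by the cardinality of the residue
field unless the exponent is a positive multiple of the order of the unit group. -/
lemma WittVector.card_dvd_sum_teichmuller_pow {e : ℕ}
    (he : 0 < e → ¬ Fintype.card K - 1 ∣ e) :
    (Fintype.card K : WittVector p K) ∣ ∑ a : K, WittVector.teichmuller p a ^ e := by
  rcases Nat.eq_zero_or_pos e with rfl | hpos
  · simp
  have hne := he hpos
  rw [← FiniteField.forall_pow_eq_one_iff K e] at hne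
  push Not at hne
  obtain ⟨g, hg⟩ := hne
  have hinv : WittVector.teichmuller p (g : K) ^ e * ∑ a : K, WittVector.teichmuller p a ^ e =
      ∑ a : K, WittVector.teichmuller p a ^ e := by
    rw [Finset.mul_sum]
    exact Fintype.sum_equiv (Units.mulLeft g) _ _ fun a => by simp [mul_pow]
  have hT : WittVector.teichmuller p (g : K) ^ e ≠ 1 := by
    intro h
    apply hg
    have := congrArg (WittVector.constantCoeff (p := p) (R := K)) h
    rw [map_pow, WittVector.constantCoeff_teichmuller, map_one] at this
    exact Units.ext (by simpa using this)
  have hzero : ∑ a : K, WittVector.teichmuller p a ^ e = 0 := by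
    by_contra h
    exact hT ((mul_eq_right₀ h).1 hinv)
  rw [hzero]
  exact dvd_zero _

variable {σ : Type*} [Fintype σ]

/-- High powers of the lifted values detect the zeros of `Φ`. -/
lemma pow_dvd_teichmullerEval_pow_sub [DecidableEq K] {m : ℕ} (hm : m ≠ 0)
    (hK : Fintype.card K = p ^ m) (Φ : MvPolynomial σ K) (t : σ → K) :
    (p : WittVector p K) ^ m ∣
      teichmullerEval p Φ t ^ (p ^ m * (p ^ m - 1)) - if eval t Φ = 0 then 0 else 1 := by
  have hp : 1 < p := (Fact.out : p.Prime).one_lt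
  have hpm : 1 < p ^ m := Nat.one_lt_pow hm hp
  split_ifs with h
  · have hdvd : (p : WittVector p K) ∣ teichmullerEval p Φ t := by
      rw [WittVector.p_dvd_iff_constantCoeff_eq_zero, constantCoeff_teichmullerEval, h]
    have hle : m ≤ p ^ m * (p ^ m - 1) :=
      (Nat.lt_pow_self hp).le.trans (Nat.le_mul_of_pos_right _ (by omega))
    rw [sub_zero]
    exact (pow_dvd_pow _ hle).trans (pow_dvd_pow_of_dvd hdvd _)
  · have hdvd : (p : WittVector p K) ∣ teichmullerEval p Φ t ^ (p ^ m - 1) - 1 := by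
      rw [WittVector.p_dvd_iff_constantCoeff_eq_zero, map_sub, map_pow,
        constantCoeff_teichmullerEval, ← hK, FiniteField.pow_card_sub_one_eq_one _ h, map_one,
        sub_self]
    have := dvd_sub_pow_of_dvd_sub hdvd m
    rw [one_pow, ← pow_mul, mul_comm] at this
    exact (pow_dvd_pow _ m.le_succ).trans this

lemma pow_dvd_sum_teichmullerEval_pow [DecidableEq σ] {m d : ℕ} (hm : m ≠ 0)
    (hK : Fintype.card K = p ^ m)
    {Φ : MvPolynomial σ K} (hΦ : Φ.IsHomogeneous d) (hd : d < Fintype.card σ) :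
    (p : WittVector p K) ^ m ∣
      ∑ t : σ → K, teichmullerEval p Φ t ^ (p ^ m * (p ^ m - 1)) := by
  classical
  have hp : 1 < p := (Fact.out : p.Prime).one_lt
  simp_rw [teichmullerEval, Finset.sum_pow_eq_sum_piAntidiag]
  rw [Finset.sum_comm]
  refine Finset.dvd_sum fun k hk => ?_
  have hksum : ∑ u ∈ Φ.support, k u = p ^ m * (p ^ m - 1) := (Finset.mem_piAntidiag.1 hk).1
  have hterm (t : σ → K) : ∏ u ∈ Φ.support, (WittVector.teichmuller p (Φ.coeff u) *
        ∏ x, WittVector.teichmuller p (t x) ^ u x) ^ k u =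
      (∏ u ∈ Φ.support, WittVector.teichmuller p (Φ.coeff u) ^ k u) *
        ∏ x, WittVector.teichmuller p (t x) ^ ∑ u ∈ Φ.support, k u * u x := by
    simp_rw [mul_pow, Finset.prod_mul_distrib, ← Finset.prod_pow, ← Finset.prod_pow_eq_pow_sum]
    rw [Finset.prod_comm]
    simp_rw [← pow_mul, mul_comm (k _)]
  simp_rw [hterm, ← Finset.mul_sum]
  have hswap := Finset.sum_prod_piFinset (Finset.univ : Finset K) fun (x : σ) a =>
    WittVector.teichmuller p a ^ ∑ u ∈ Φ.support, k u * u x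
  rw [Fintype.piFinset_univ] at hswap
  rw [hswap]
  by_cases hgood : ∀ x, 0 < ∑ u ∈ Φ.support, k u * u x ∧
      p ^ m - 1 ∣ ∑ u ∈ Φ.support, k u * u x
  · refine Dvd.dvd.mul_right ?_ _
    have hdeg : ∀ u ∈ Φ.support, ∑ x, u x = d := fun u hu => by
      rw [← Finsupp.degree_eq_sum]
      exact (hΦ.degree_eq_sum_deg_support hu).symm
    have hle := two_mul_le_sum_sum_digits hp hm hd Φ.support hdeg k
      (hksum ▸ dvd_mul_left _ _) (fun x => (hgood x).2) fun x => (hgood x).1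
    have hval := Nat.sub_one_mul_padicValNat_multinomial (p := p) Φ.support k
    rw [hksum, Nat.sum_digits_pow_mul hp, Nat.sum_digits_pow_sub_one hp] at hval
    have hmv : m ≤ padicValNat p (Nat.multinomial Φ.support k) := by
      refine Nat.le_of_mul_le_mul_left ?_ (Nat.sub_pos_of_lt hp)
      rw [mul_comm _ m]
      omega
    exact WittVector.pow_dvd_natCast_iff.2 ((pow_dvd_pow p hmv).trans pow_padicValNat_dvd)
  · push Not at hgood
    obtain ⟨x, hx⟩ := hgood
    have := WittVector.card_dvd_sum_teichmuller_pow (p := p) (K := K) (hK ▸ hx)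
    rw [hK, Nat.cast_pow] at this
    have hprod := Finset.dvd_prod_of_mem
      (fun x : σ => ∑ a : K, WittVector.teichmuller p a ^ ∑ u ∈ Φ.support, k u * u x)
      (Finset.mem_univ x)
    exact dvd_mul_of_dvd_right (dvd_mul_of_dvd_right (this.trans hprod) _) _

end WittVector

/-- **Ax's theorem** for a homogeneous polynomial: if the degree is less than the number of
variables, the number of zeros in affine space is divisible by the cardinality of the field. -/
theorem MvPolynomial.IsHomogeneous.card_dvd_card_zeros {K σ : Type*} [Field K] [Fintype K]
    [Fintype σ] {d : ℕ} {Φ : MvPolynomial σ K} (hΦ : Φ.IsHomogeneous d)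
    (hd : d < Fintype.card σ) :
    Fintype.card K ∣ Nat.card {t : σ → K // eval t Φ = 0} := by
  classical
  obtain ⟨p, hchar, m, hprime, hK⟩ := FiniteField.card' K
  have : Fact p.Prime := ⟨hprime⟩
  have hsum := pow_dvd_sum_teichmullerEval_pow (p := p) m.ne_zero hK hΦ hd
  have hsub := Finset.dvd_sum fun t (_ : t ∈ (Finset.univ : Finset (σ → K))) =>
    pow_dvd_teichmullerEval_pow_sub (p := p) m.ne_zero hK Φ t
  rw [Finset.sum_sub_distrib, dvd_sub_right hsum] at hsub
  have hne : p ^ (m : ℕ) ∣ Fintype.card {t : σ → K // ¬ eval t Φ = 0} := by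
    rw [← WittVector.pow_dvd_natCast_iff (K := K), Fintype.card_subtype, Finset.natCast_card_filter]
    simpa only [ite_not] using hsub
  have hall : p ^ (m : ℕ) ∣ Fintype.card (σ → K) := by
    rw [Fintype.card_fun, hK]
    exact dvd_pow_self _ (by omega)
  rw [Nat.card_eq_fintype_card, hK]
  rw [Fintype.card_subtype_compl] at hne
  exact (Nat.dvd_sub_iff_right (Fintype.card_subtype_le _) hall).1 hne

lemma MvPolynomial.IsHomogeneous.eval_smul {R σ : Type*} [CommRing R] {d : ℕ}
    {Φ : MvPolynomial σ R} (hΦ : Φ.IsHomogeneous d) (a : R) (v : σ → R) :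
    eval (a • v) Φ = a ^ d * eval v Φ := by
  rw [eval_eq, eval_eq, Finset.mul_sum]
  refine Finset.sum_congr rfl fun u hu => ?_
  rw [hΦ.degree_eq_sum_deg_support hu]
  simp [mul_pow, Finset.prod_mul_distrib, Finset.prod_pow_eq_pow_sum]
  ring

/-- The nonzero affine zeros of a homogeneous polynomial are the nonzero multiples of the
representatives of its projective zeros. -/
lemma MvPolynomial.IsHomogeneous.card_nonzero_zeros {K σ : Type*} [Field K] {d : ℕ}
    {Φ : MvPolynomial σ K} (hΦ : Φ.IsHomogeneous d) :
    Nat.card {v : σ → K // v ≠ 0 ∧ eval v Φ = 0} =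
      Nat.card {P : Projectivization K (σ → K) // eval P.rep Φ = 0} * Nat.card Kˣ := by
  rw [← Nat.card_prod]
  refine (Nat.card_congr (Equiv.ofBijective (fun x => ⟨x.2 • x.1.1.rep,
    (smul_ne_zero_iff_ne x.2).2 x.1.1.rep_nonzero,
    by rw [Units.smul_def, hΦ.eval_smul, x.1.2, mul_zero]⟩) ⟨?_, ?_⟩)).symm
  · rintro ⟨⟨P, hP⟩, a⟩ ⟨⟨Q, hQ⟩, b⟩ h
    have h : a • P.rep = b • Q.rep := congrArg Subtype.val h
    obtain rfl : P = Q := by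
      rw [← P.mk_rep, ← Q.mk_rep, Projectivization.mk_eq_mk_iff]
      exact ⟨a⁻¹ * b, by rw [mul_smul, ← h, inv_smul_smul]⟩
    have hab : (a : K) = b := smul_left_injective K P.rep_nonzero h
    rw [Units.ext hab]
  · rintro ⟨v, hv, hv0⟩
    obtain ⟨a, ha⟩ := Projectivization.exists_smul_eq_mk_rep K v hv
    refine ⟨⟨⟨Projectivization.mk K v hv, ?_⟩, a⁻¹⟩, Subtype.ext ?_⟩
    · rw [← ha, Units.smul_def, hΦ.eval_smul, hv0, mul_zero]
    · simp [← ha]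

/-- **Chevalley–Warning–Ax**: over a finite field `𝔽` with `q` elements, the number of points
of the projective hypersurface defined by a homogeneous polynomial `Φ` of degree `d ≥ 1` in
`n + 1` variables, with `n ≥ d`, is congruent to `1` modulo `q`; in particular the hypersurface
has an `𝔽`-rational point. -/
theorem chevalley_warning_ax (𝔽 : Type*) [Field 𝔽] [Fintype 𝔽] (q : ℕ)
    (hq : Fintype.card 𝔽 = q) (n d : ℕ) (hd : 1 ≤ d) (hnd : d ≤ n)
    (Φ : MvPolynomial (Fin (n + 1)) 𝔽) (hΦ : Φ.IsHomogeneous d) :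
    Nat.card {P : Projectivization 𝔽 (Fin (n + 1) → 𝔽) // eval P.rep Φ = 0} ≡ 1 [MOD q] ∧
    ∃ P : Projectivization 𝔽 (Fin (n + 1) → 𝔽), eval P.rep Φ = 0 := by
  subst hq
  have hmod : Nat.card {P : Projectivization 𝔽 (Fin (n + 1) → 𝔽) // eval P.rep Φ = 0} ≡ 1
      [MOD Fintype.card 𝔽] := by
    classical
    have hax := hΦ.card_dvd_card_zeros (by simpa using Nat.lt_succ_of_le hnd)
    have hzero : eval (0 : Fin (n + 1) → 𝔽) Φ = 0 := by
      simpa [show d ≠ 0 by omega] using hΦ.eval_smul 0 0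
    have hsplit : Nat.card {v : Fin (n + 1) → 𝔽 // eval v Φ = 0} =
        Nat.card {v : Fin (n + 1) → 𝔽 // v ≠ 0 ∧ eval v Φ = 0} + 1 := by
      have hset : {v : Fin (n + 1) → 𝔽 | eval v Φ = 0} =
          insert 0 {v : Fin (n + 1) → 𝔽 | v ≠ 0 ∧ eval v Φ = 0} := by
        ext v
        rcases eq_or_ne v 0 with rfl | hv
        · exact iff_of_true hzero (Set.mem_insert _ _)
        · simp [hv]
      exact (congrArg Set.ncard hset).trans (Set.ncard_insert_of_notMem (by simp))
    rw [hsplit, hΦ.card_nonzero_zeros, Nat.card_units, Nat.card_eq_fintype_card (α := 𝔽)] at hax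
    obtain ⟨r, hr⟩ : ∃ r, Fintype.card 𝔽 = r + 1 :=
      ⟨_, (Nat.sub_add_cancel Fintype.card_pos).symm⟩
    rw [hr, Nat.add_sub_cancel] at hax
    rw [hr]
    generalize Nat.card {P : Projectivization 𝔽 (Fin (n + 1) → 𝔽) // eval P.rep Φ = 0} = N at *
    rw [Nat.modEq_iff_dvd]
    have hax : ((r + 1 : ℕ) : ℤ) ∣ N * r + 1 := by exact_mod_cast hax
    rw [show ((1 : ℕ) : ℤ) - N = N * r + 1 - N * ((r + 1 : ℕ) : ℤ) by push_cast; ring]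
    exact hax.sub (dvd_mul_left _ _)
  refine ⟨hmod, ?_⟩
  by_contra! hempty
  have : IsEmpty {P : Projectivization 𝔽 (Fin (n + 1) → 𝔽) // eval P.rep Φ = 0} :=
    ⟨fun P => hempty P.1 P.2⟩
  rw [Nat.card_of_isEmpty] at hmod
  have hdvd := (Nat.modEq_iff_dvd' (Nat.zero_le 1)).1 hmod
  exact Fintype.one_lt_card.ne' (Nat.dvd_one.1 hdvd)
end
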